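/- Every 1-planar graph with minimum degree 7 contains a vertex w₀ of degree 7 and a neighbor w₁ of w₀ of degree 7 such that w₀ and w₁ lie on a common triangle of the graph, and all seven neighbors of w₀ have degree at most 23. -/

import Mathlib

/-- A 1-planar drawing of a simple graph in the plane: vertices at distinct
points, each edge an injective continuous arc between the images of its
endpoints, arc interiors avoiding vertices, any two arcs crossing in at most
one interior point, and every edge crossing at most one other edge. -/
structure OnePlanarDrawing {V : Type*} (G : SimpleGraph V) where
  pos : V → ℝ × ℝ
  pos_inj : Function.Injective pos
  arc : G.edgeSet → ℝ → ℝ × ℝ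
  arc_cont : ∀ e, ContinuousOn (arc e) (Set.Icc 0 1)
  arc_inj : ∀ e, Set.InjOn (arc e) (Set.Icc 0 1)
  arc_ends : ∀ e : G.edgeSet, ∃ u v : V, (e : Sym2 V) = s(u, v) ∧
      arc e 0 = pos u ∧ arc e 1 = pos v
  arc_avoids : ∀ e, ∀ t ∈ Set.Ioo (0 : ℝ) 1, arc e t ∉ Set.range pos
  crossings_subsingleton : ∀ e f : G.edgeSet, e ≠ f →
      (arc e '' Set.Ioo 0 1 ∩ arc f '' Set.Ioo 0 1).Subsingleton
  at_most_one_crossing : ∀ e : G.edgeSet,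
      {f : G.edgeSet | f ≠ e ∧
        (arc e '' Set.Ioo 0 1 ∩ arc f '' Set.Ioo 0 1).Nonempty}.Subsingleton

/-- A graph is 1-planar if it admits a drawing in the plane in which every
edge crosses at most one other edge. -/
def SimpleGraph.IsOnePlanar {V : Type*} (G : SimpleGraph V) : Prop :=
  Nonempty (OnePlanarDrawing G)

open Classical in
/-- The amount a vertex sends to the regions at its uncrossed corners. -/
noncomputable def LinkSystem.tax {V : Type*} [Fintype V] (G : SimpleGraph V) [DecidableRel G.Adj]
    (v : V) : ℚ :=
  if G.degree v = 7 then (if ∀ u, G.Adj v u → G.degree u ≤ 23 then 0 else 1 / 3) else 1 / 2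

theorem LinkSystem.tax_nonneg {V : Type*} [Fintype V] {G : SimpleGraph V} [DecidableRel G.Adj]
    (v : V) : 0 ≤ tax G v := by
  unfold tax
  split_ifs <;> norm_num

open Classical in
/-- A vertex of large degree gives a third to each of its neighbours. -/
noncomputable def LinkSystem.gift {V : Type*} [Fintype V] (G : SimpleGraph V) [DecidableRel G.Adj]
    (v : V) : ℚ :=
  if 24 ≤ G.degree v then 1 / 3 else 0

theorem LinkSystem.gift_nonneg {V : Type*} [Fintype V] {G : SimpleGraph V} [DecidableRel G.Adj]
    (v : V) : 0 ≤ gift G v := by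
  unfold gift
  split_ifs <;> norm_num

theorem LinkSystem.one_le_sum_tax {V : Type*} [Fintype V] {G : SimpleGraph V} [DecidableRel G.Adj]
    (h : ∀ u v w, G.Adj u v → G.Adj u w → G.Adj v w → G.degree u = 7 →
    G.degree v = 7 → ∃ x, G.Adj u x ∧ 23 < G.degree x) (a b c : V) (hab : G.Adj a b)
    (hbc : G.Adj b c) (hca : G.Adj c a) : 1 ≤ tax G a + tax G b + tax G c := by
  have key : ∀ u v w, G.Adj u v → G.Adj u w → G.Adj v w →
      1 / 3 ≤ tax G u ∨ tax G v = 1 / 2 := fun u v w huv huw hvw => by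
    by_cases hu : G.degree u = 7
    · by_cases hv : G.degree v = 7
      · obtain ⟨x, hx, hx'⟩ := h u v w huv huw hvw hu hv
        refine Or.inl ?_
        rw [tax, if_pos hu, if_neg fun h => absurd (h x hx) (by omega)]
      · exact Or.inr (if_neg hv)
    · refine Or.inl ?_
      rw [tax, if_neg hu]
      norm_num
  have ha := tax_nonneg (G := G) a
  have hb := tax_nonneg (G := G) b
  have hc := tax_nonneg (G := G) c
  rcases key a b c hab hca.symm hbc with h1 | h1 <;>
  rcases key a c b hca.symm hab hbc.symm with h2 | h2 <;>
  rcases key b a c hab.symm hbc hca.symm with h3 | h3 <;>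
  rcases key b c a hbc hab.symm hca with h4 | h4 <;>
  rcases key c a b hca hbc.symm hab with h5 | h5 <;>
  rcases key c b a hbc.symm hca hab.symm with h6 | h6 <;> linarith

/-- The combinatorial trace of a 1-planar drawing. The rotation `rot` turns a dart around its
source; the links join the two darts of an uncrossed edge, and the four darts of a pair of crossing
edges in cyclic order. Even sets of half-edges are boundaries of two-colourings. -/
structure LinkSystem {V : Type*} [Fintype V] [DecidableEq V] (G : SimpleGraph V)
    [DecidableRel G.Adj] where
  rot : Equiv.Perm G.Dart
  link : Equiv.Perm G.Dart
  twist : G.Dart → ZMod 2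
  Crossed : G.Dart → Prop
  rot_fst : ∀ d, (rot d).fst = d.fst
  rot_ne : ∀ d, rot d ≠ d
  link_of_not_crossed : ∀ d, ¬Crossed d → link d = d.symm
  crossed_link : ∀ d, Crossed (link d) ↔ Crossed d
  link_link : ∀ d, Crossed d → link (link d) = d.symm
  link_fst : ∀ d, Crossed d → (link d).fst ≠ d.fst
  exists_coloring : ∀ z : G.Dart → ZMod 2, (∀ v, (∑ d, if d.fst = v then z d else 0) = 0) →
    (∀ d, ¬Crossed d → z d.symm = z d) →
    (∀ d, Crossed d → z d + z (link d) + z d.symm + z (link d.symm) = 0) →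
    ∃ g₀ g₁ : G.Dart → ZMod 2, (∀ d, g₀ (rot d) = g₀ d + z (rot d)) ∧
      (∀ d, g₁ (link d) = g₁ d + z (link d)) ∧ ∀ d, g₁ d = g₀ d + twist d * z d

namespace LinkSystem

variable {V : Type*} [Fintype V] [DecidableEq V] {G : SimpleGraph V} [DecidableRel G.Adj]
  (S : LinkSystem G)

/-- A side of a dart. -/
abbrev Flag (_S : LinkSystem G) : Type _ := G.Dart × ZMod 2

/-- Pass to the other side of a corner at a vertex. -/
def corner (x : S.Flag) : S.Flag :=
  if x.2 = 0 then (S.rot x.1, 1) else (S.rot.symm x.1, 0)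

/-- Walk along an edge, turning at a crossing. -/
def walk (x : S.Flag) : S.Flag :=
  if x.2 + S.twist x.1 = 0 then (S.link x.1, 1 + S.twist (S.link x.1))
  else (S.link.symm x.1, S.twist (S.link.symm x.1))

theorem zmod_two (s : ZMod 2) : s = 0 ∨ s = 1 := by
  revert s
  decide

theorem rot_symm_fst (d : G.Dart) : (S.rot.symm d).fst = d.fst := by
  rw [← S.rot_fst, Equiv.apply_symm_apply]

theorem corner_corner (x : S.Flag) : S.corner (S.corner x) = x := by
  obtain ⟨h, s⟩ := x
  rcases zmod_two s with rfl | rfl <;> simp [corner]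

theorem corner_fst (x : S.Flag) : (S.corner x).1.fst = x.1.fst := by
  unfold corner
  split_ifs
  · exact S.rot_fst _
  · exact S.rot_symm_fst _

theorem corner_dart_ne (x : S.Flag) : (S.corner x).1 ≠ x.1 := by
  unfold corner
  split_ifs
  · exact S.rot_ne _
  · intro h
    exact S.rot_ne _ (by rw [← (Equiv.symm_apply_eq _).1 h])

theorem corner_ne (x : S.Flag) : S.corner x ≠ x := fun h =>
  S.corner_dart_ne x (congrArg Prod.fst h)

theorem walk_walk (x : S.Flag) : S.walk (S.walk x) = x := by
  obtain ⟨h, s⟩ := x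
  by_cases hs : s + S.twist h = 0
  · have h1 : S.walk (h, s) = (S.link h, 1 + S.twist (S.link h)) := if_pos hs
    have h2 : (1 + S.twist (S.link h) + S.twist (S.link h) : ZMod 2) ≠ 0 := by
      rw [add_assoc, CharTwo.add_self_eq_zero, add_zero]
      exact one_ne_zero
    rw [h1, walk, if_neg h2]
    simp only [Equiv.symm_apply_apply, Prod.mk.injEq, true_and]
    exact (CharTwo.add_eq_zero.1 hs).symm
  · have h1 : S.walk (h, s) = (S.link.symm h, S.twist (S.link.symm h)) := if_neg hs
    rw [h1, walk, if_pos (CharTwo.add_self_eq_zero _)]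
    simp only [Equiv.apply_symm_apply, Prod.mk.injEq, true_and]
    have h3 := (zmod_two (s + S.twist h)).resolve_left hs
    rw [← h3, add_assoc, CharTwo.add_self_eq_zero, add_zero]

theorem crossed_link_symm (d : G.Dart) : S.Crossed (S.link.symm d) ↔ S.Crossed d := by
  rw [← S.crossed_link, Equiv.apply_symm_apply]

theorem crossed_walk (x : S.Flag) : S.Crossed (S.walk x).1 ↔ S.Crossed x.1 := by
  unfold walk
  split_ifs
  · exact S.crossed_link _
  · exact S.crossed_link_symm _

theorem walk_of_not_crossed (x : S.Flag) (hx : ¬S.Crossed x.1) : (S.walk x).1 = x.1.symm := by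
  unfold walk
  split_ifs
  · exact S.link_of_not_crossed _ hx
  · have h := S.link_of_not_crossed _ ((S.crossed_link_symm x.1).not.2 hx)
    rw [Equiv.apply_symm_apply] at h
    conv_rhs => rw [h]
    rw [SimpleGraph.Dart.symm_symm]

theorem walk_fst (x : S.Flag) : (S.walk x).1.fst ≠ x.1.fst := by
  by_cases hx : S.Crossed x.1
  · unfold walk
    split_ifs
    · exact S.link_fst _ hx
    · have h := S.link_fst _ ((S.crossed_link_symm x.1).2 hx)
      rw [Equiv.apply_symm_apply] at h
      exact h.symm
  · rw [S.walk_of_not_crossed x hx]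
    exact x.1.adj.ne'

theorem walk_ne (x : S.Flag) : S.walk x ≠ x := fun h =>
  S.walk_fst x (by rw [h])

/-- Two flags are adjacent along the boundary of a region. -/
def Step (x y : S.Flag) : Prop := y = S.corner x ∨ y = S.walk x

/-- The regions of the drawing. -/
abbrev Region : Type _ := Quot S.Step

noncomputable instance : Fintype S.Region := Fintype.ofFinite _

theorem region_corner (x : S.Flag) : (Quot.mk S.Step (S.corner x)) = Quot.mk S.Step x :=
  (Quot.sound (show S.Step x (S.corner x) from Or.inl rfl)).symm

theorem region_walk (x : S.Flag) : (Quot.mk S.Step (S.walk x)) = Quot.mk S.Step x :=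
  (Quot.sound (show S.Step x (S.walk x) from Or.inr rfl)).symm

/-- The difference of the colours on the two sides of a dart. -/
noncomputable def jump : (S.Region → ZMod 2) →ₗ[ZMod 2] (G.Dart → ZMod 2) where
  toFun f d := f (Quot.mk _ (d, 0)) + f (Quot.mk _ (d, 1))
  map_add' f g := by
    ext d
    simp only [Pi.add_apply]
    ring
  map_smul' a f := by
    ext d
    simp only [Pi.smul_apply, smul_eq_mul, RingHom.id_apply]
    ring

/-- The darts that meet the same edge or crossing. -/
abbrev Node : Type _ := Quotient (Equiv.Perm.SameCycle.setoid S.link)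

noncomputable instance : Fintype S.Node := Fintype.ofFinite _

open Classical in
/-- The parity conditions at the vertices and at the nodes. -/
noncomputable def parity :
    (G.Dart → ZMod 2) →ₗ[ZMod 2] (V → ZMod 2) × (S.Node → ZMod 2) where
  toFun z := (fun v => ∑ d, if d.fst = v then z d else 0,
    fun q => if S.Crossed q.out then z q.out + z (S.link q.out) + z q.out.symm +
      z (S.link q.out.symm) else z q.out + z q.out.symm)
  map_add' z w := by
    refine Prod.ext (funext fun v => ?_) (funext fun q => ?_)
    · simp only [Pi.add_apply, Prod.mk_add_mk, ← Finset.sum_add_distrib]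
      refine Finset.sum_congr rfl fun d _ => ?_
      split_ifs <;> simp
    · simp only [Pi.add_apply, Prod.mk_add_mk]
      split_ifs <;> ring
  map_smul' a z := by
    refine Prod.ext (funext fun v => ?_) (funext fun q => ?_)
    · simp only [Pi.smul_apply, smul_eq_mul, RingHom.id_apply, Prod.smul_mk, Finset.mul_sum,
        mul_ite, mul_zero]
    · simp only [Pi.smul_apply, smul_eq_mul, RingHom.id_apply, Prod.smul_mk]
      split_ifs <;> ring

theorem link_symm_of_crossed {d : G.Dart} (hd : S.Crossed d) : S.Crossed d.symm := by
  rw [← S.link_link d hd, S.crossed_link, S.crossed_link]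
  exact hd

theorem crossed_symm (d : G.Dart) : S.Crossed d.symm ↔ S.Crossed d :=
  ⟨fun h => by simpa using S.link_symm_of_crossed h, S.link_symm_of_crossed⟩

/-- The orbit of a dart under the link permutation. -/
theorem sameCycle_iff (d k : G.Dart) : S.link.SameCycle d k ↔
    k = d ∨ k = d.symm ∨ S.Crossed d ∧ (k = S.link d ∨ k = S.link d.symm) := by
  constructor
  · intro h
    obtain ⟨n, rfl⟩ := h.exists_nat_pow_eq
    clear h
    induction n with
    | zero => exact Or.inl rfl
    | succ n ih =>
      rw [pow_succ', Equiv.Perm.mul_apply]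
      by_cases hd : S.Crossed d
      · have h1 := S.link_link d hd
        have h2 := S.link_link d.symm ((S.crossed_symm d).2 hd)
        rw [SimpleGraph.Dart.symm_symm] at h2
        rcases ih with h | h | ⟨-, h | h⟩ <;> rw [h] <;> simp [hd, h1, h2]
      · have h1 := S.link_of_not_crossed d hd
        have h2 := S.link_of_not_crossed d.symm ((S.crossed_symm d).not.2 hd)
        rw [SimpleGraph.Dart.symm_symm] at h2
        rcases ih with h | h | ⟨h, -⟩
        · rw [h, h1]; simp
        · rw [h, h2]; simp
        · exact absurd h hd
  · have h0 : ∀ d, S.link.SameCycle d (S.link d) := fun d => ⟨1, by simp⟩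
    have h1 : S.link.SameCycle d d.symm := by
      by_cases hd : S.Crossed d
      · rw [← S.link_link d hd]
        exact (h0 d).trans (h0 _)
      · rw [← S.link_of_not_crossed d hd]
        exact h0 d
    rintro (rfl | rfl | ⟨-, rfl | rfl⟩)
    · exact Equiv.Perm.SameCycle.refl _ _
    · exact h1
    · exact h0 d
    · exact h1.trans (h0 _)

open Classical in
theorem sum_node : ∑ d : G.Dart, (if S.Crossed d then 1 else 2 : ℕ) =
    4 * Fintype.card S.Node := by
  rw [← Finset.sum_fiberwise Finset.univ (fun d => (⟦d⟧ : S.Node)), mul_comm,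
    ← smul_eq_mul, ← Finset.card_univ, ← Finset.sum_const]
  refine Finset.sum_congr rfl fun q _ => ?_
  induction q using Quotient.inductionOn with
  | _ d =>
  have hmem : ∀ k, (⟦k⟧ : S.Node) = ⟦d⟧ ↔ S.link.SameCycle d k := fun k =>
    Quotient.eq.trans Equiv.Perm.sameCycle_comm
  simp only [hmem, sameCycle_iff]
  have hne : d.symm ≠ d := d.symm_ne
  by_cases hd : S.Crossed d
  · have hs := (S.crossed_symm d).2 hd
    have h1 := S.link_link d hd
    have h2 := S.link_link d.symm hs
    rw [SimpleGraph.Dart.symm_symm] at h2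
    have h3 : S.link d ≠ d := fun h => S.link_fst d hd (by rw [h])
    have h4 : S.link d.symm ≠ d.symm := fun h => S.link_fst _ hs (by rw [h])
    have h5 : S.link d ≠ S.link d.symm := fun h => hne (S.link.injective h).symm
    have h6 : S.link d ≠ d.symm := fun h => h3 (S.link.injective (by rw [h1, h]))
    have h7 : S.link d.symm ≠ d := fun h => h4 (S.link.injective (by rw [h2, h]))
    have : Finset.univ.filter (fun k => k = d ∨ k = d.symm ∨ S.Crossed d ∧
        (k = S.link d ∨ k = S.link d.symm)) = {d, d.symm, S.link d, S.link d.symm} := by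
      ext k
      simp [hd]
    rw [this, Finset.sum_insert (by simp [hne.symm, h3.symm, h7.symm]),
      Finset.sum_insert (by simp [h6.symm, h4.symm]), Finset.sum_insert (by simp [h5]),
      Finset.sum_singleton]
    simp [hd, hs, S.crossed_link]
  · have : Finset.univ.filter (fun k => k = d ∨ k = d.symm ∨ S.Crossed d ∧
        (k = S.link d ∨ k = S.link d.symm)) = {d, d.symm} := by
      ext k
      simp [hd]
    rw [this, Finset.sum_insert (by simp [hne.symm]), Finset.sum_singleton]
    simp [hd, (S.crossed_symm d).not.2 hd]

theorem exists_jump_eq {z : G.Dart → ZMod 2} (hz : S.parity z = 0) : ∃ f, S.jump f = z := by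
  classical
  have hv : ∀ v, (∑ d, if d.fst = v then z d else 0) = 0 := fun v =>
    congrFun (congrArg Prod.fst hz) v
  have hq : ∀ q : S.Node, (if S.Crossed q.out then z q.out + z (S.link q.out) + z q.out.symm +
      z (S.link q.out.symm) else z q.out + z q.out.symm) = 0 := fun q =>
    congrFun (congrArg Prod.snd hz) q
  have hout : ∀ d : G.Dart, d = (⟦d⟧ : S.Node).out ∨ d = (⟦d⟧ : S.Node).out.symm ∨
      S.Crossed (⟦d⟧ : S.Node).out ∧
      (d = S.link (⟦d⟧ : S.Node).out ∨ d = S.link (⟦d⟧ : S.Node).out.symm) := fun d =>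
    (S.sameCycle_iff _ _).1 (Quotient.mk_out (s := Equiv.Perm.SameCycle.setoid S.link) d)
  obtain ⟨g₀, g₁, h0, h1, h2⟩ := S.exists_coloring z hv
    (fun d hd => by
      have h := hq ⟦d⟧
      rcases hout d with h' | h' | ⟨h', h'' | h''⟩
      · rw [← h', if_neg hd] at h
        exact (CharTwo.add_eq_zero.1 h).symm
      · have h3 : ¬S.Crossed (⟦d⟧ : S.Node).out := by rwa [← S.crossed_symm, ← h']
        rw [if_neg h3, ← h'] at h
        rw [← CharTwo.add_eq_zero.1 h]
        conv_lhs => rw [h']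
        rw [SimpleGraph.Dart.symm_symm]
      · exact absurd (by rw [h'', S.crossed_link]; exact h') hd
      · exact absurd (by rw [h'', S.crossed_link, S.crossed_symm]; exact h') hd)
    (fun d hd => by
      have h := hq ⟦d⟧
      set k := (⟦d⟧ : S.Node).out with hk
      have hkc : S.Crossed k := by
        rcases hout d with h' | h' | ⟨h', -⟩
        · rwa [← show d = k from h']
        · rwa [← S.crossed_symm, ← h']
        · exact h'
      have h3 := S.link_link k hkc
      have h4 := S.link_link k.symm ((S.crossed_symm k).2 hkc)
      rw [SimpleGraph.Dart.symm_symm] at h4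
      have h5 := S.link_link _ ((S.crossed_link k).2 hkc)
      rw [h3] at h5
      rw [if_pos hkc] at h
      rcases hout d with h' | h' | ⟨-, h' | h'⟩ <;> rw [h', ← h]
      · rw [SimpleGraph.Dart.symm_symm]
        ring
      · rw [← h5, h3, h4]
        ring
      · rw [h4, h5, SimpleGraph.Dart.symm_symm, h3]
        ring)
  let val : S.Flag → ZMod 2 := fun x => g₀ x.1 + x.2 * z x.1
  have hval : ∀ x y, S.Step x y → val x = val y := by
    rintro ⟨d, s⟩ y (rfl | rfl)
    · rcases zmod_two s with rfl | rfl
      · have h3 := h0 d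
        simp only [val, corner, if_true, h3]
        linear_combination -CharTwo.add_self_eq_zero (z (S.rot d))
      · have h3 := h0 (S.rot.symm d)
        rw [Equiv.apply_symm_apply] at h3
        simp only [val, corner, one_ne_zero, if_false, h3]
        linear_combination CharTwo.add_self_eq_zero (z d)
    · by_cases hs : s + S.twist d = 0
      · have h3 := h2 (S.link d)
        rw [h1, h2] at h3
        simp only [val, walk, if_pos hs]
        rw [CharTwo.add_eq_zero.1 hs]
        linear_combination h3 - CharTwo.add_self_eq_zero (z (S.link d))
      · have h3 := h1 (S.link.symm d)
        rw [Equiv.apply_symm_apply, h2, h2] at h3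
        have h4 : s = 1 - S.twist d := eq_sub_of_add_eq ((zmod_two _).resolve_left hs)
        simp only [val, walk, if_neg hs]
        rw [h4]
        linear_combination h3 + CharTwo.add_self_eq_zero (z d) -
          CharTwo.add_self_eq_zero (S.twist d * z d)
  refine ⟨Quot.lift val hval, funext fun d => ?_⟩
  change val (d, 0) + val (d, 1) = z d
  simp only [val, zero_mul, one_mul, add_zero]
  rw [← add_assoc, CharTwo.add_self_eq_zero, zero_add]

/-- Euler's inequality. -/
theorem card_region [Nonempty G.Dart] :
    1 + Fintype.card G.Dart ≤ Fintype.card S.Region + Fintype.card V + Fintype.card S.Node := by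
  have h1 := S.jump.finrank_range_add_finrank_ker
  have h2 := S.parity.finrank_range_add_finrank_ker
  have h3 := S.parity.range.finrank_le
  have h4 : Module.finrank (ZMod 2) S.parity.ker ≤ Module.finrank (ZMod 2) S.jump.range :=
    Submodule.finrank_mono fun z hz => S.exists_jump_eq hz
  have h5 : 0 < Module.finrank (ZMod 2) S.jump.ker := by
    obtain ⟨d⟩ := ‹Nonempty G.Dart›
    have : Nontrivial S.jump.ker :=
      ⟨⟨0, ⟨fun _ => 1, funext fun _ => CharTwo.add_self_eq_zero _⟩, fun h =>
        zero_ne_one (congrFun (congrArg Subtype.val h) (Quot.mk _ (d, 0)))⟩⟩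
    exact Module.finrank_pos
  simp only [Module.finrank_prod, Module.finrank_fintype_fun_eq_card] at h1 h2 h3
  omega

open Classical in
/-- The length of a dart, counted in half-edges and crossings. -/
noncomputable def length (d : G.Dart) : ℚ := if S.Crossed d then 2 else 1

open Classical in
/-- The amount that the vertex of a corner sends to the region of the corner. -/
noncomputable def pay (p : V → ℚ) (x : S.Flag) : ℚ :=
  if S.Crossed x.1 ↔ S.Crossed (S.corner x).1 then (if S.Crossed x.1 then 0 else p x.1.fst)
  else 1 / 2

/-- The share of a flag in the final weight of its region. -/
noncomputable def weight (p : V → ℚ) (x : S.Flag) : ℚ := (S.length x.1 + S.pay p x) / 2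

theorem one_le_length (d : G.Dart) : 1 ≤ S.length d := by
  unfold length
  split_ifs <;> norm_num

theorem length_walk (x : S.Flag) : S.length (S.walk x).1 = S.length x.1 := by
  by_cases h : S.Crossed x.1 <;> simp [length, S.crossed_walk x, h]

theorem length_of_crossed {d : G.Dart} (hd : S.Crossed d) : S.length d = 2 := if_pos hd

theorem pay_nonneg {p : V → ℚ} (hp : ∀ v, 0 ≤ p v) (x : S.Flag) : 0 ≤ S.pay p x := by
  unfold pay
  split_ifs
  · rfl
  · exact hp _
  · norm_num

theorem pay_corner (p : V → ℚ) (x : S.Flag) : S.pay p (S.corner x) = S.pay p x := by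
  unfold pay
  rw [S.corner_corner, S.corner_fst]
  by_cases h1 : S.Crossed x.1 <;> by_cases h2 : S.Crossed (S.corner x).1 <;> simp [h1, h2]

theorem pay_of_alternating {p : V → ℚ} {x : S.Flag}
    (hx : ¬(S.Crossed x.1 ↔ S.Crossed (S.corner x).1)) : S.pay p x = 1 / 2 := if_neg hx

theorem pay_of_not_crossed {p : V → ℚ} {x : S.Flag} (hx : ¬S.Crossed x.1)
    (hx' : ¬S.Crossed (S.corner x).1) : S.pay p x = p x.1.fst := by
  rw [pay, if_pos (by tauto), if_neg hx]

theorem weight_add_corner (p : V → ℚ) (x : S.Flag) : S.weight p x + S.weight p (S.corner x) =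
    (S.length x.1 + S.length (S.corner x).1) / 2 + S.pay p x := by
  rw [weight, weight, pay_corner]
  ring

theorem weight_nonneg {p : V → ℚ} (hp : ∀ v, 0 ≤ p v) (x : S.Flag) : 0 ≤ S.weight p x := by
  have h1 := S.one_le_length x.1
  have h2 := S.pay_nonneg hp x
  unfold weight
  linarith

theorem one_le_weight_add_corner {p : V → ℚ} (hp : ∀ v, 0 ≤ p v) (x : S.Flag) :
    1 ≤ S.weight p x + S.weight p (S.corner x) := by
  rw [weight_add_corner]
  have h1 := S.one_le_length x.1
  have h2 := S.one_le_length (S.corner x).1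
  have h3 := S.pay_nonneg hp x
  linarith

theorem corner_mem_insert {T : Finset S.Flag} (hT : ∀ y ∈ T, S.corner y ∈ T) (x : S.Flag) :
    ∀ y ∈ insert x (insert (S.corner x) T), S.corner y ∈ insert x (insert (S.corner x) T) := by
  intro y hy
  simp only [Finset.mem_insert] at hy ⊢
  rcases hy with rfl | rfl | hy
  · exact Or.inr (Or.inl rfl)
  · exact Or.inl (S.corner_corner x)
  · exact Or.inr (Or.inr (hT y hy))

theorem sum_insert_corner {T : Finset S.Flag} (hT : ∀ y ∈ T, S.corner y ∈ T) {x : S.Flag}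
    (hx : x ∉ T) (f : S.Flag → ℚ) :
    ∑ y ∈ insert x (insert (S.corner x) T), f y = f x + f (S.corner x) + ∑ y ∈ T, f y := by
  have hx' : S.corner x ∉ T := fun h => hx (by simpa [S.corner_corner] using hT _ h)
  rw [Finset.sum_insert, Finset.sum_insert hx', add_assoc]
  simp [hx, (S.corner_ne x).symm]

theorem four_le_digon {p : V → ℚ} {x₀ y₀ x₁ y₁ : S.Flag} (h₀ : S.corner x₀ = y₀)
    (h₀₁ : S.walk y₀ = x₁) (h₁ : S.corner x₁ = y₁) (h₁₀ : S.walk y₁ = x₀) (hp : ∀ v, 0 ≤ p v) :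
    4 ≤ S.weight p x₁ + S.weight p y₁ + (S.weight p x₀ + S.weight p y₀) := by
  rw [← h₀, ← h₁, weight_add_corner, weight_add_corner, h₀, h₁]
  have e₁ := S.length_walk y₀
  have e₀ := S.length_walk y₁
  have k₁ := S.crossed_walk y₀
  have k₀ := S.crossed_walk y₁
  rw [h₀₁] at e₁ k₁
  rw [h₁₀] at e₀ k₀
  have q₀ := S.pay_nonneg hp x₀
  have q₁ := S.pay_nonneg hp x₁
  by_cases a : S.Crossed y₀.1 ↔ S.Crossed y₁.1
  · by_cases a₀ : S.Crossed y₀.1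
    · have b₀ := S.length_of_crossed a₀
      have b₁ := S.length_of_crossed (a.1 a₀)
      linarith
    · refine absurd ?_ (S.corner_dart_ne x₁)
      have m₁ := S.walk_of_not_crossed y₀ a₀
      have m₀ := S.walk_of_not_crossed y₁ (a.not.1 a₀)
      rw [h₀₁] at m₁
      rw [h₁₀] at m₀
      have f₀ := S.corner_fst x₀
      have f₁ := S.corner_fst x₁
      rw [h₁] at f₁ ⊢
      refine SimpleGraph.Dart.ext _ _ (Prod.ext f₁ ?_)
      rw [m₁, ← y₁.1.symm_symm, ← m₀]
      exact (h₀ ▸ f₀).symm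
  · have b₀ : S.pay p x₀ = 1 / 2 := S.pay_of_alternating (by rw [h₀, k₀]; tauto)
    have b₁ : S.pay p x₁ = 1 / 2 := S.pay_of_alternating (by rw [h₁, k₁]; tauto)
    by_cases a₀ : S.Crossed y₀.1
    · have c₀ := S.length_of_crossed a₀
      have c₁ := S.one_le_length y₁.1
      linarith
    · have c₀ := S.length_of_crossed (d := y₁.1) (by tauto)
      have c₁ := S.one_le_length y₀.1
      linarith

theorem four_le_triangle {p : V → ℚ} {x₀ y₀ x₁ y₁ x₂ y₂ : S.Flag} (h₀ : S.corner x₀ = y₀)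
    (h₀₁ : S.walk y₀ = x₁) (h₁ : S.corner x₁ = y₁) (h₁₂ : S.walk y₁ = x₂)
    (h₂ : S.corner x₂ = y₂) (h₂₀ : S.walk y₂ = x₀) (hp : ∀ v, 0 ≤ p v)
    (htri : ∀ a b c, G.Adj a b → G.Adj b c → G.Adj c a → 1 ≤ p a + p b + p c) :
    4 ≤ S.weight p x₂ + S.weight p y₂ +
      (S.weight p x₁ + S.weight p y₁ + (S.weight p x₀ + S.weight p y₀)) := by
  rw [← h₀, ← h₁, ← h₂, weight_add_corner, weight_add_corner, weight_add_corner, h₀, h₁, h₂]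
  have e₁ := S.length_walk y₀
  have e₂ := S.length_walk y₁
  have e₀ := S.length_walk y₂
  rw [h₀₁] at e₁
  rw [h₁₂] at e₂
  rw [h₂₀] at e₀
  have q₀ := S.pay_nonneg hp x₀
  have q₁ := S.pay_nonneg hp x₁
  have q₂ := S.pay_nonneg hp x₂
  have l₀ := S.one_le_length y₀.1
  have l₁ := S.one_le_length y₁.1
  have l₂ := S.one_le_length y₂.1
  by_cases a₀ : S.Crossed y₀.1
  · have b := S.length_of_crossed a₀
    linarith
  by_cases a₁ : S.Crossed y₁.1
  · have b := S.length_of_crossed a₁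
    linarith
  by_cases a₂ : S.Crossed y₂.1
  · have b := S.length_of_crossed a₂
    linarith
  have key : ∀ x y z : S.Flag, S.corner x = y → S.walk y = z → ¬S.Crossed y.1 →
      G.Adj x.1.fst z.1.fst := by
    rintro x _ _ rfl rfl h
    rw [S.walk_of_not_crossed _ h, ← S.corner_fst x]
    exact (S.corner x).1.adj
  have k₁ := S.crossed_walk y₀
  have k₂ := S.crossed_walk y₁
  have k₀ := S.crossed_walk y₂
  rw [h₀₁] at k₁
  rw [h₁₂] at k₂
  rw [h₂₀] at k₀
  have u₀ := S.pay_of_not_crossed (p := p) (x := x₀) (by rwa [k₀]) (by rwa [h₀])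
  have u₁ := S.pay_of_not_crossed (p := p) (x := x₁) (by rwa [k₁]) (by rwa [h₁])
  have u₂ := S.pay_of_not_crossed (p := p) (x := x₂) (by rwa [k₂]) (by rwa [h₂])
  have t := htri _ _ _ (key _ _ _ h₀ h₀₁ a₀) (key _ _ _ h₁ h₁₂ a₁) (key _ _ _ h₂ h₂₀ a₂)
  linarith

open Classical in
/-- Every region ends up with weight at least four. -/
theorem four_le_region {p : V → ℚ} (hp : ∀ v, 0 ≤ p v)
    (htri : ∀ a b c, G.Adj a b → G.Adj b c → G.Adj c a → 1 ≤ p a + p b + p c) (r : S.Region) :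
    4 ≤ ∑ x : S.Flag, if Quot.mk S.Step x = r then S.weight p x else 0 := by
  induction r using Quot.inductionOn with
  | _ x₀ =>
  rw [← Finset.sum_filter]
  suffices h : ∃ T : Finset S.Flag, (∀ x ∈ T, Quot.mk S.Step x = Quot.mk S.Step x₀) ∧
      4 ≤ ∑ x ∈ T, S.weight p x by
    obtain ⟨T, hT, h4⟩ := h
    refine h4.trans (Finset.sum_le_sum_of_subset_of_nonneg (fun x hx => ?_)
      fun x _ _ => S.weight_nonneg hp x)
    simpa using hT x hx
  obtain ⟨y₀, hy₀⟩ : ∃ y, S.corner x₀ = y := ⟨_, rfl⟩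
  obtain ⟨x₁, hx₁⟩ : ∃ y, S.walk y₀ = y := ⟨_, rfl⟩
  obtain ⟨y₁, hy₁⟩ : ∃ y, S.corner x₁ = y := ⟨_, rfl⟩
  obtain ⟨x₂, hx₂⟩ : ∃ y, S.walk y₁ = y := ⟨_, rfl⟩
  obtain ⟨y₂, hy₂⟩ : ∃ y, S.corner x₂ = y := ⟨_, rfl⟩
  obtain ⟨x₃, hx₃⟩ : ∃ y, S.walk y₂ = y := ⟨_, rfl⟩
  have rc : ∀ {x y : S.Flag}, S.corner x = y → Quot.mk S.Step x = Quot.mk S.Step x₀ →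
      Quot.mk S.Step y = Quot.mk S.Step x₀ := fun h h' => h ▸ (S.region_corner _).trans h'
  have hmk : ∀ {x y : S.Flag}, S.walk x = y → Quot.mk S.Step x = Quot.mk S.Step x₀ →
      Quot.mk S.Step y = Quot.mk S.Step x₀ := fun h h' => h ▸ (S.region_walk _).trans h'
  have ry₀ := rc hy₀ rfl
  have rx₁ := hmk hx₁ ry₀
  have ry₁ := rc hy₁ rx₁
  have rx₂ := hmk hx₂ ry₁
  have ry₂ := rc hy₂ rx₂
  have rx₃ := hmk hx₃ ry₂
  have f₁ : y₁.1.fst = x₁.1.fst := hy₁ ▸ S.corner_fst x₁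
  have f₂ : y₂.1.fst = x₂.1.fst := hy₂ ▸ S.corner_fst x₂
  have hne : ∀ {x y : S.Flag}, x.1.fst ≠ y.1.fst → x ≠ y := fun h h' => h (by rw [h'])
  have step : ∀ {x y z : S.Flag}, S.corner x = y → S.walk y = z → z ≠ x ∧ z ≠ y := by
    rintro x _ _ rfl rfl
    exact ⟨hne (S.corner_fst x ▸ S.walk_fst _), S.walk_ne _⟩
  have winj : Function.Injective S.walk := Function.LeftInverse.injective S.walk_walk
  have t₀ : ∀ y ∈ (∅ : Finset S.Flag), S.corner y ∈ (∅ : Finset S.Flag) := by simp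
  have t₁ := S.corner_mem_insert t₀ x₀
  have t₂ := S.corner_mem_insert t₁ x₁
  have t₃ := S.corner_mem_insert t₂ x₂
  have s₁ := S.sum_insert_corner t₀ (Finset.notMem_empty x₀) (S.weight p)
  have s₂ := S.sum_insert_corner t₁ (x := x₁)
    (by simpa [hy₀] using step hy₀ hx₁) (S.weight p)
  rw [Finset.sum_empty, add_zero] at s₁
  rw [s₁, hy₀, hy₁] at s₂
  by_cases h₂ : x₂ = x₀
  · refine ⟨_, ?_, s₂.ge.trans' (S.four_le_digon hy₀ hx₁ hy₁ (hx₂.trans h₂) hp)⟩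
    simp [ry₀, rx₁, ry₁]
  have i₂ : x₂ ≠ y₀ := fun h => S.corner_ne x₁ (winj (by rw [hy₁, hx₂, h, ← hx₁, S.walk_walk]))
  have s₃ := S.sum_insert_corner t₂ (x := x₂) (by
    simpa [hy₀, hy₁, h₂, i₂] using step hy₁ hx₂) (S.weight p)
  rw [hy₀, hy₁, s₂, hy₂] at s₃
  by_cases h₃ : x₃ = x₀
  · refine ⟨_, ?_, s₃.ge.trans' (S.four_le_triangle hy₀ hx₁ hy₁ hx₂ hy₂ (hx₃.trans h₃) hp htri)⟩
    simp [ry₀, rx₁, ry₁, rx₂, ry₂]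
  have g₂ : x₂.1.fst ≠ x₁.1.fst := by
    rw [← f₁, ← hx₂]
    exact S.walk_fst y₁
  have i₃ : x₃ ≠ y₀ := fun h => g₂ (by rw [← f₂, ← S.walk_walk y₂, hx₃, h, hx₁])
  have j₃ : x₃ ≠ x₁ := fun h => h₂ (by
    rw [← S.corner_corner x₂, ← S.corner_corner x₀, hy₂, hy₀,
      winj (hx₃.trans (h.trans hx₁.symm))])
  have l₃ : x₃ ≠ y₁ := fun h => S.corner_ne x₂ (by
    rw [hy₂, ← S.walk_walk y₂, hx₃, h, hx₂])
  have s₄ := S.sum_insert_corner t₃ (x := x₃) (by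
    simpa [hy₀, hy₁, hy₂, h₃, i₃, j₃, l₃] using step hy₂ hx₃) (S.weight p)
  rw [hy₀, hy₁, hy₂, s₃] at s₄
  refine ⟨_, ?_, s₄.ge.trans' ?_⟩
  · simp [ry₀, rx₁, ry₁, rx₂, ry₂, rx₃, rc rfl rx₃]
  have w₀ := S.one_le_weight_add_corner hp x₀
  have w₁ := S.one_le_weight_add_corner hp x₁
  have w₂ := S.one_le_weight_add_corner hp x₂
  have w₃ := S.one_le_weight_add_corner hp x₃
  rw [hy₀] at w₀
  rw [hy₁] at w₁
  rw [hy₂] at w₂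
  linarith

theorem sum_weight (p : V → ℚ) :
    ∑ x : S.Flag, S.weight p x = ∑ d, S.length d + ∑ d, S.pay p (d, 0) := by
  have h : ∀ d, S.pay p (d, 1) = S.pay p (S.rot.symm d, 0) := fun d => by
    rw [← S.pay_corner]
    rfl
  have h2 : ∀ d, ∑ s : ZMod 2, S.weight p (d, s) =
      S.length d + (S.pay p (d, 0) / 2 + S.pay p (S.rot.symm d, 0) / 2) := fun d => by
    rw [← h]
    refine (Fin.sum_univ_two _).trans ?_
    change S.weight p (d, 0) + S.weight p (d, 1) = _
    rw [weight, weight]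
    ring
  rw [Fintype.sum_prod_type, Finset.sum_congr rfl fun d _ => h2 d, Finset.sum_add_distrib,
    Finset.sum_add_distrib, Equiv.sum_comp S.rot.symm fun d => S.pay p (d, 0) / 2,
    ← Finset.sum_add_distrib (f := fun d => S.pay p (d, 0) / 2)]
  simp only [add_halves]

open Classical in
theorem sum_length : ∑ d, S.length d =
    3 * (Fintype.card G.Dart : ℚ) - 4 * (Fintype.card S.Node : ℚ) := by
  have h : (∑ d : G.Dart, (if S.Crossed d then 1 else 2 : ℕ) : ℚ) =
      4 * (Fintype.card S.Node : ℚ) := by exact_mod_cast S.sum_node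
  rw [← h, eq_sub_iff_add_eq, ← Finset.sum_add_distrib, Fintype.card, ← nsmul_eq_mul',
    ← Finset.sum_const]
  refine Finset.sum_congr rfl fun d _ => ?_
  unfold length
  split_ifs <;> norm_num

open Classical in
/-- The number of corners at a vertex between a crossed and an uncrossed edge is even. -/
theorem even_alternating (v : V) : Even (Finset.univ.filter fun d : G.Dart =>
    d.fst = v ∧ ¬(S.Crossed d ↔ S.Crossed (S.rot d))).card := by
  rw [← ZMod.natCast_eq_zero_iff_even, Finset.card_filter, Nat.cast_sum]
  have h : ∀ d : G.Dart, ((if d.fst = v ∧ ¬(S.Crossed d ↔ S.Crossed (S.rot d)) then 1 else 0 : ℕ)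
      : ZMod 2) = (if d.fst = v ∧ S.Crossed d then 1 else 0) +
        if (S.rot d).fst = v ∧ S.Crossed (S.rot d) then 1 else 0 := fun d => by
    rw [S.rot_fst]
    by_cases h1 : d.fst = v <;> by_cases h2 : S.Crossed d <;>
      by_cases h3 : S.Crossed (S.rot d) <;> simp [h1, h2, h3, CharTwo.add_self_eq_zero]
  rw [Finset.sum_congr rfl fun d _ => h d, Finset.sum_add_distrib,
    Equiv.sum_comp S.rot fun d => if d.fst = v ∧ S.Crossed d then (1 : ZMod 2) else 0,
    CharTwo.add_self_eq_zero]

theorem card_dart_fiber (v : V) :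
    (Finset.univ.filter fun d : G.Dart => d.fst = v).card = G.degree v := by
  simpa using G.dart_fst_fiber_card_eq_degree v

theorem sum_pay_le_half (v : V) :
    ∑ d : G.Dart with d.fst = v, S.pay (tax G) (d, 0) ≤ G.degree v * (1 / 2) := by
  rw [← card_dart_fiber, ← nsmul_eq_mul]
  refine Finset.sum_le_card_nsmul _ _ _ fun d _ => ?_
  unfold pay tax
  split_ifs <;> norm_num

/-- The budget of a vertex of degree seven. -/
theorem sum_pay_le_of_degree_eq (v : V) (hv : G.degree v = 7) :
    ∑ d : G.Dart with d.fst = v, S.pay (tax G) (d, 0) ≤ 3 + tax G v := by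
  classical
  have hcard := card_dart_fiber (G := G) v
  rw [hv] at hcard
  have heven := S.even_alternating v
  rw [← Finset.filter_filter] at heven
  set D := Finset.univ.filter fun d : G.Dart => d.fst = v with hD
  set A := D.filter fun d => ¬(S.Crossed d ↔ S.Crossed (S.rot d)) with hA
  have hA6 : A.card ≤ 6 := by
    have h1 : A.card ≤ 7 := hcard ▸ Finset.card_filter_le _ _
    obtain ⟨k, hk⟩ := heven
    omega
  have ht := tax_nonneg (G := G) v
  have ht' : tax G v ≤ 1 / 3 := by
    rw [tax, if_pos hv]
    split_ifs <;> norm_num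
  have hle : ∀ d ∈ D, S.pay (tax G) (d, 0) ≤
      (if ¬(S.Crossed d ↔ S.Crossed (S.rot d)) then 1 / 2 - tax G v else 0) + tax G v := by
    intro d hd
    have hdv : d.fst = v := by simpa [hD] using hd
    have hc : S.corner (d, 0) = (S.rot d, 1) := rfl
    unfold pay
    rw [hc]
    simp only [hdv]
    split_ifs <;> linarith
  refine (Finset.sum_le_sum hle).trans ?_
  rw [Finset.sum_add_distrib, ← Finset.sum_filter, Finset.sum_const, Finset.sum_const, hcard,
    ← hA, nsmul_eq_mul, nsmul_eq_mul]
  have h6 : (A.card : ℚ) ≤ 6 := by exact_mod_cast hA6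
  push_cast
  nlinarith

theorem vertex_budget (v : V) (hv : 7 ≤ G.degree v) :
    ∑ d : G.Dart with d.fst = v, (S.pay (tax G) (d, 0) + gift G d.fst - gift G d.snd) ≤
      ∑ d : G.Dart with d.fst = v, (1 : ℚ) - 4 := by
  rw [Finset.sum_sub_distrib, Finset.sum_add_distrib, Finset.sum_const, card_dart_fiber,
    nsmul_one]
  have h1 : ∑ d : G.Dart with d.fst = v, gift G d.fst = G.degree v * gift G v := by
    rw [← card_dart_fiber, ← nsmul_eq_mul, ← Finset.sum_const]
    refine Finset.sum_congr rfl fun d hd => ?_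
    rw [(Finset.mem_filter.1 hd).2]
  have h2 : 0 ≤ ∑ d : G.Dart with d.fst = v, gift G d.snd :=
    Finset.sum_nonneg fun d _ => gift_nonneg _
  have h3 := S.sum_pay_le_half v
  rw [h1]
  rcases hv.eq_or_lt with h7 | h7
  · have h4 := S.sum_pay_le_of_degree_eq v h7.symm
    have h5 : tax G v ≤ ∑ d : G.Dart with d.fst = v, gift G d.snd := by
      rw [tax, if_pos h7.symm]
      split_ifs with h
      · exact h2
      · push Not at h
        obtain ⟨u, hu, hu'⟩ := h
        refine le_trans ?_ (Finset.single_le_sum (f := fun d : G.Dart => gift G d.snd)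
          (fun d _ => gift_nonneg d.snd) (a := ⟨(v, u), hu⟩) (by simp))
        simp [gift, show 24 ≤ G.degree u from hu']
    have h6 : gift G v = 0 := by simp [gift, ← h7]
    rw [h6, ← h7]
    push_cast
    linarith
  · by_cases h24 : 24 ≤ G.degree v
    · have h5 : (24 : ℚ) ≤ G.degree v := by exact_mod_cast h24
      rw [gift, if_pos h24]
      linarith
    · have h5 : (8 : ℚ) ≤ G.degree v := by exact_mod_cast h7
      rw [gift, if_neg h24]
      linarith

theorem sum_pay_le (hmin : ∀ v, 7 ≤ G.degree v) :
    ∑ d : G.Dart, S.pay (tax G) (d, 0) ≤ Fintype.card G.Dart - 4 * (Fintype.card V : ℚ) := by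
  have h := Finset.sum_le_sum fun v (_ : v ∈ Finset.univ) => S.vertex_budget v (hmin v)
  rw [Finset.sum_fiberwise, Finset.sum_sub_distrib, Finset.sum_add_distrib, Finset.sum_sub_distrib,
    Finset.sum_fiberwise] at h
  have hs : ∑ d : G.Dart, gift G d.snd = ∑ d : G.Dart, gift G d.fst :=
    Equiv.sum_comp (SimpleGraph.Dart.symm_involutive (G := G)).toPerm fun d => gift G d.fst
  rw [hs] at h
  simp only [Finset.sum_const, Finset.card_univ, nsmul_eq_mul, mul_one] at h
  linarith

theorem exists_light_triangle [Nonempty V] (S : LinkSystem G) (hmin : ∀ v, 7 ≤ G.degree v) :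
    ∃ u v w, G.Adj u v ∧ G.Adj u w ∧ G.Adj v w ∧ G.degree u = 7 ∧ G.degree v = 7 ∧
      ∀ x, G.Adj u x → G.degree x ≤ 23 := by
  by_contra! hcon
  have : Nonempty G.Dart := by
    obtain ⟨v⟩ := ‹Nonempty V›
    obtain ⟨w, hw⟩ := (G.degree_pos_iff_exists_adj v).1 (by have := hmin v; omega)
    exact ⟨⟨(v, w), hw⟩⟩
  classical
  have h1 := Finset.sum_le_sum fun r (_ : r ∈ Finset.univ) =>
    S.four_le_region (tax_nonneg (G := G)) (one_le_sum_tax hcon) r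
  rw [Finset.sum_comm] at h1
  simp only [Finset.sum_ite_eq, Finset.mem_univ, if_true, Finset.sum_const, Finset.card_univ,
    nsmul_eq_mul] at h1
  rw [S.sum_weight, S.sum_length] at h1
  have h2 := S.sum_pay_le hmin
  have h3 : (1 + Fintype.card G.Dart : ℚ) ≤
      Fintype.card S.Region + Fintype.card V + Fintype.card S.Node := by
    exact_mod_cast S.card_region
  linarith

end LinkSystem

theorem Equiv.Perm.SameCycle.of_forall_apply {α : Type*} [Finite α] {f : Equiv.Perm α} {x y : α}
    (h : f.SameCycle x y) {P : α → Prop} (hP : ∀ a, P a → P (f a)) (hx : P x) : P y := by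
  obtain ⟨n, rfl⟩ := h.exists_nat_pow_eq
  clear h
  induction n with
  | zero => exact hx
  | succ n ih =>
    rw [pow_succ', Equiv.Perm.mul_apply]
    exact hP _ ih

/-- The order in which the darts leave the midpoints or crossing points of their edges: `node`
names the point, and at most two edges meet there. -/
structure NodeRotation {V : Type*} (G : SimpleGraph V) (α : Type*) where
  node : G.Dart → α
  turn : Equiv.Perm G.Dart
  node_symm : ∀ d, node d.symm = node d
  node_three : ∀ d k l, node k = node d → node l = node d → k.edge = d.edge ∨ l.edge = d.edge ∨
    k.edge = l.edge
  node_turn : ∀ d, node (turn d) = node d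
  sameCycle : ∀ d k, node k = node d → turn.SameCycle d k

namespace NodeRotation

variable {V : Type*} {G : SimpleGraph V} {α : Type*} (N : NodeRotation G α)

theorem node_turn_symm (d : G.Dart) : N.node (N.turn.symm d) = N.node d := by
  rw [← N.node_turn, Equiv.apply_symm_apply]

theorem eq_or_of_node {d k l : G.Dart} (hk : N.node k = N.node d) (hl : N.node l = N.node d)
    (h1 : k ≠ d) (h2 : k ≠ d.symm) : l = d ∨ l = d.symm ∨ l = k ∨ l = k.symm := by
  have := N.node_three d k l hk hl
  simp only [SimpleGraph.dart_edge_eq_iff] at this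
  rcases this with (h | h) | (h | h) | h | h
  · exact absurd h h1
  · exact absurd h h2
  · exact Or.inl h
  · exact Or.inr (Or.inl h)
  · exact Or.inr (Or.inr (Or.inl h.symm))
  · exact Or.inr (Or.inr (Or.inr (by rw [h, SimpleGraph.Dart.symm_symm])))

/-- The two edges at the node of a dart alternate around it. -/
def Alternates (d : G.Dart) : Prop := N.turn (N.turn d) = d.symm

open Classical in
/-- Two adjacent edges that alternate around their node are redrawn without a crossing, by
exchanging their initial parts. -/
noncomputable def uncross (d : G.Dart) : G.Dart :=
  if N.Alternates d then
    if (N.turn d).fst = d.fst then N.turn d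
    else if (N.turn.symm d).fst = d.fst then N.turn.symm d else d
  else d

theorem uncross_of_not_alternates {d : G.Dart} (h : ¬N.Alternates d) : N.uncross d = d := if_neg h

theorem uncross_of_turn {d : G.Dart} (h : N.Alternates d) (h' : (N.turn d).fst = d.fst) :
    N.uncross d = N.turn d := by
  rw [uncross, if_pos h, if_pos h']

theorem uncross_of_turn_symm {d : G.Dart} (h : N.Alternates d) (h' : (N.turn d).fst ≠ d.fst)
    (h'' : (N.turn.symm d).fst = d.fst) : N.uncross d = N.turn.symm d := by
  rw [uncross, if_pos h, if_neg h', if_pos h'']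

theorem uncross_of_ne {d : G.Dart} (h' : (N.turn d).fst ≠ d.fst)
    (h'' : (N.turn.symm d).fst ≠ d.fst) : N.uncross d = d := by
  simp [uncross, h', h'']

theorem uncross_fst (d : G.Dart) : (N.uncross d).fst = d.fst := by
  unfold uncross
  split_ifs <;> first | assumption | rfl

theorem node_uncross (d : G.Dart) : N.node (N.uncross d) = N.node d := by
  unfold uncross
  split_ifs
  exacts [N.node_turn d, N.node_turn_symm d, rfl, rfl]

/-- Edges that alternate around their node without sharing a vertex. -/
def Crossed (d : G.Dart) : Prop :=
  N.Alternates d ∧ ∀ k, N.node k = N.node d → (N.turn k).fst ≠ k.fst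

theorem uncross_of_crossed {d : G.Dart} (h : N.Crossed d) : N.uncross d = d :=
  N.uncross_of_ne (h.2 d rfl) fun e => h.2 _ (N.node_turn_symm d) (by
    rw [e, Equiv.apply_symm_apply])

variable [Finite G.Dart]

theorem turn_ne (d : G.Dart) : N.turn d ≠ d := fun h =>
  d.symm_ne ((N.sameCycle _ _ (N.node_symm d)).of_forall_apply (P := fun k => k = d)
    (fun _ ha => ha.symm ▸ h) rfl)

theorem turn_of_alternates {d : G.Dart} (h : N.Alternates d) :
    N.turn d.symm = (N.turn d).symm ∧ N.turn (N.turn d).symm = d := by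
  unfold Alternates at h
  set a := N.turn d with ha
  have hinj := N.turn.injective
  have hne := N.turn_ne
  have hss := SimpleGraph.Dart.symm_symm (G := G)
  have hsn := SimpleGraph.Dart.symm_ne (G := G)
  have na : N.node a = N.node d := N.node_turn d
  have a1 : a ≠ d := N.turn_ne d
  have a2 : a ≠ d.symm := fun e => N.turn_ne a (h.trans e.symm)
  have hcl := fun l (hl : N.node l = N.node d) => N.eq_or_of_node na hl a1 a2
  have nd : N.node d.symm = N.node d := N.node_symm d
  have nas : N.node a.symm = N.node d := (N.node_symm a).trans na
  have h1 := hcl _ ((N.node_turn d.symm).trans nd)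
  have h2 := hcl _ ((N.node_turn a.symm).trans nas)
  have h3 : N.turn d.symm ≠ a := fun e => hsn d (hinj (e.trans ha))
  have h4 : N.turn a.symm ≠ a := fun e => a2 (by rw [← hss a, hinj (e.trans ha)])
  have h5 : N.turn a.symm ≠ d.symm := fun e => hsn a (hinj (e.trans h.symm))
  have h6 := hne d.symm
  have h7 := hne a.symm
  have h8 : N.turn d.symm = a.symm := by grind
  exact ⟨h8, by grind⟩

theorem alternates_turn {d : G.Dart} (h : N.Alternates d) : N.Alternates (N.turn d) := by
  rw [Alternates, show N.turn (N.turn d) = d.symm from h]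
  exact (N.turn_of_alternates h).1

theorem alternates_of_node {d k : G.Dart} (hk : N.node k = N.node d) (h : N.Alternates d) :
    N.Alternates k :=
  (N.sameCycle _ _ hk).of_forall_apply (fun _ => N.alternates_turn) h

theorem turn_of_not_alternates {d : G.Dart} (h : ¬N.Alternates d) :
    N.turn d = d.symm ∨ N.turn d.symm = d := by
  by_contra! hcon
  obtain ⟨a2, c1⟩ := hcon
  unfold Alternates at h
  set a := N.turn d with ha
  have hinj := N.turn.injective
  have hne := N.turn_ne
  have hss := SimpleGraph.Dart.symm_symm (G := G)
  have hsn := SimpleGraph.Dart.symm_ne (G := G)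
  have na : N.node a = N.node d := N.node_turn d
  have a1 : a ≠ d := N.turn_ne d
  have hcl := fun l (hl : N.node l = N.node d) => N.eq_or_of_node na hl a1 a2
  have nd : N.node d.symm = N.node d := N.node_symm d
  have h1 := hcl _ ((N.node_turn d.symm).trans nd)
  have h2 := hcl _ ((N.node_turn a).trans na)
  have h3 : N.turn d.symm ≠ a := fun e => hsn d (hinj (e.trans ha))
  have h6 := hne d.symm
  have h7 := hne a
  have h8 : N.turn d.symm = a.symm := by grind
  have h9 : N.turn a ≠ a.symm := fun e => a2 (hinj (e.trans h8.symm))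
  have h10 : N.turn a = d := by grind
  rcases (N.sameCycle _ _ nd).of_forall_apply (P := fun k => k = d ∨ k = a)
    (by rintro k (rfl | rfl); exacts [Or.inr ha.symm, Or.inl h10]) (Or.inl rfl) with e | e
  · exact hsn d e
  · exact a2 e.symm

theorem crossed_of_node {d k : G.Dart} (hk : N.node k = N.node d) (h : N.Crossed d) :
    N.Crossed k :=
  ⟨N.alternates_of_node hk h.1, fun l hl => h.2 l (hl.trans hk)⟩

theorem crossed_turn (d : G.Dart) : N.Crossed (N.turn d) ↔ N.Crossed d :=
  ⟨N.crossed_of_node (N.node_turn d).symm, N.crossed_of_node (N.node_turn d)⟩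

theorem crossed_turn_symm (d : G.Dart) : N.Crossed (N.turn.symm d) ↔ N.Crossed d :=
  ⟨N.crossed_of_node (N.node_turn_symm d).symm, N.crossed_of_node (N.node_turn_symm d)⟩

theorem crossed_symm (d : G.Dart) : N.Crossed d.symm ↔ N.Crossed d :=
  ⟨N.crossed_of_node (N.node_symm d).symm, N.crossed_of_node (N.node_symm d)⟩

theorem uncross_turn {d : G.Dart} (h : N.Alternates d) (h' : (N.turn d).fst = d.fst) :
    N.uncross (N.turn d) = d := by
  rw [N.uncross_of_turn_symm (N.alternates_turn h), Equiv.symm_apply_apply]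
  · rw [show N.turn (N.turn d) = d.symm from h, h']
    exact d.adj.ne'
  · rw [Equiv.symm_apply_apply, h']

theorem uncross_uncross (d : G.Dart) : N.uncross (N.uncross d) = d := by
  by_cases h : N.Alternates d
  · by_cases h' : (N.turn d).fst = d.fst
    · rw [N.uncross_of_turn h h', N.uncross_turn h h']
    · by_cases h'' : (N.turn.symm d).fst = d.fst
      · rw [N.uncross_of_turn_symm h h' h'', N.uncross_of_turn
          (N.alternates_of_node (N.node_turn_symm d) h), Equiv.apply_symm_apply]
        rw [Equiv.apply_symm_apply, h'']
      · rw [N.uncross_of_ne h' h'', N.uncross_of_ne h' h'']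
  · rw [N.uncross_of_not_alternates h, N.uncross_of_not_alternates h]

/-- In the redrawn system the two halves of an uncrossed edge are neighbours around the node. -/
theorem turn_uncross {d : G.Dart} (h : ¬N.Crossed d) :
    N.turn (N.uncross d) = N.uncross d.symm ∨ N.turn (N.uncross d.symm) = N.uncross d := by
  by_cases ha : N.Alternates d
  · simp only [Crossed, ha, true_and, not_forall, not_not] at h
    obtain ⟨k, hk, hkf⟩ := h
    have hak := N.alternates_of_node hk ha
    obtain ⟨h1, h2⟩ := N.turn_of_alternates hak
    have h0 : N.turn (N.turn k) = k.symm := hak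
    set l := N.turn k with hl
    have l1 : l ≠ k := N.turn_ne k
    have l2 : l ≠ k.symm := fun e => N.turn_ne l (h0.trans e.symm)
    have hsnd : k.snd ≠ l.snd := fun e => l1 (SimpleGraph.Dart.ext _ _ (Prod.ext hkf e.symm))
    have u1 : N.uncross k = l := N.uncross_of_turn hak hkf
    have u2 : N.uncross l = k := N.uncross_turn hak hkf
    have u3 : N.uncross k.symm = k.symm := by
      refine N.uncross_of_ne ?_ ?_
      · rw [h1]
        exact hsnd.symm
      · rw [← h0, Equiv.symm_apply_apply, h0, hkf]
        exact k.adj.ne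
    have u4 : N.uncross l.symm = l.symm := by
      refine N.uncross_of_ne ?_ ?_
      · rw [h2, ← hkf]
        exact l.adj.ne
      · rw [← h1, Equiv.symm_apply_apply, h1]
        exact hsnd
    have hdl := N.eq_or_of_node (N.node_turn k) hk.symm l1 l2
    rw [← hl] at hdl
    rcases hdl with e | e | e | e <;>
      rw [e] <;> simp [u1, u2, u3, u4, h0, h2]
  · have hs : ¬N.Alternates d.symm := fun e => ha (N.alternates_of_node (N.node_symm d).symm e)
    rw [N.uncross_of_not_alternates ha, N.uncross_of_not_alternates hs]
    exact N.turn_of_not_alternates ha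

open Classical in
/-- The links of the redrawn system. -/
noncomputable def link : Equiv.Perm G.Dart where
  toFun d := if N.Crossed d then N.turn d else d.symm
  invFun d := if N.Crossed d then N.turn.symm d else d.symm
  left_inv d := by
    by_cases h : N.Crossed d <;> simp [h, crossed_turn, crossed_symm]
  right_inv d := by
    by_cases h : N.Crossed d <;> simp [h, crossed_turn_symm, crossed_symm]

theorem link_of_crossed {d : G.Dart} (h : N.Crossed d) : N.link d = N.turn d := if_pos h

theorem link_of_not_crossed {d : G.Dart} (h : ¬N.Crossed d) : N.link d = d.symm := if_neg h

theorem node_link (d : G.Dart) : N.node (N.link d) = N.node d := by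
  by_cases h : N.Crossed d
  · rw [N.link_of_crossed h, N.node_turn]
  · rw [N.link_of_not_crossed h, N.node_symm]

theorem crossed_link (d : G.Dart) : N.Crossed (N.link d) ↔ N.Crossed d :=
  ⟨N.crossed_of_node (N.node_link d).symm, N.crossed_of_node (N.node_link d)⟩

theorem sum_node_eq_zero [Fintype V] [DecidableEq V] [DecidableRel G.Adj] [DecidableEq α]
    {z : G.Dart → ZMod 2}
    (h1 : ∀ d, ¬N.Crossed d → z d.symm = z d)
    (h2 : ∀ d, N.Crossed d → z d + z (N.link d) + z d.symm + z (N.link d.symm) = 0) (d : G.Dart) :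
    (∑ k, if N.node k = N.node d then z k else 0) = 0 := by
  rw [← Finset.sum_filter]
  have hne := d.symm_ne
  by_cases hk : ∃ k, N.node k = N.node d ∧ k ≠ d ∧ k ≠ d.symm
  · obtain ⟨k, hk, hk1, hk2⟩ := hk
    have hF : ∀ k, N.node k = N.node d → k ≠ d → k ≠ d.symm →
        ∑ k with N.node k = N.node d, z k = z d + (z d.symm + (z k + z k.symm)) := by
      intro k hk hk1 hk2
      have : Finset.univ.filter (fun l => N.node l = N.node d) = {d, d.symm, k, k.symm} := by
        ext l
        simp only [Finset.mem_filter, Finset.mem_univ, true_and, Finset.mem_insert,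
          Finset.mem_singleton]
        refine ⟨fun hl => N.eq_or_of_node hk hl hk1 hk2, ?_⟩
        rintro (rfl | rfl | rfl | rfl)
        exacts [rfl, N.node_symm _, hk, (N.node_symm _).trans hk]
      have hks : k.symm ≠ d := fun e => hk2 (by rw [← e, SimpleGraph.Dart.symm_symm])
      have hks' : k.symm ≠ d.symm := fun e => hk1 (by
        rw [← k.symm_symm, e, SimpleGraph.Dart.symm_symm])
      rw [this, Finset.sum_insert (by simp [hne.symm, hk1.symm, hks.symm]),
        Finset.sum_insert (by simp [hk2.symm, hks'.symm]),
        Finset.sum_insert (by simp [k.symm_ne.symm]), Finset.sum_singleton]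
    by_cases hc : N.Crossed d
    · have ht : N.turn d ≠ d.symm := fun e => N.turn_ne (N.turn d) (hc.1.trans e.symm)
      have hd := h2 d hc
      rw [N.link_of_crossed hc, N.link_of_crossed ((N.crossed_symm d).2 hc),
        (N.turn_of_alternates hc.1).1] at hd
      rw [hF _ (N.node_turn d) (N.turn_ne d) ht, ← hd]
      ring
    · rw [hF k hk hk1 hk2, h1 d hc, h1 k (fun h => hc (N.crossed_of_node hk.symm h)), ← add_assoc,
        CharTwo.add_self_eq_zero, CharTwo.add_self_eq_zero, add_zero]
  · push Not at hk
    have hc : ¬N.Crossed d := fun hc => N.turn_ne (N.turn d)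
      (hc.1.trans (hk _ (N.node_turn d) (N.turn_ne d)).symm)
    have : Finset.univ.filter (fun l => N.node l = N.node d) = {d, d.symm} := by
      ext l
      simp only [Finset.mem_filter, Finset.mem_univ, true_and, Finset.mem_insert,
        Finset.mem_singleton]
      refine ⟨fun hl => or_iff_not_imp_left.2 (hk l hl), ?_⟩
      rintro (rfl | rfl)
      exacts [rfl, N.node_symm _]
    rw [this, Finset.sum_insert (by simp [hne.symm]), Finset.sum_singleton, h1 d hc,
      CharTwo.add_self_eq_zero]

/-- The permutation underlying `uncross`. -/
noncomputable def uncrossPerm : Equiv.Perm G.Dart := Function.Involutive.toPerm _ N.uncross_uncross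

/-- The redrawn system. -/
noncomputable def linkSystem [Fintype V] [DecidableEq V] [DecidableRel G.Adj] [DecidableEq α]
    (rot : Equiv.Perm G.Dart) (twist : G.Dart → ZMod 2)
    (rot_fst : ∀ d, (rot d).fst = d.fst) (rot_ne : ∀ d, rot d ≠ d)
    (exists_coloring : ∀ z : G.Dart → ZMod 2, (∀ v, (∑ d, if d.fst = v then z d else 0) = 0) →
      (∀ d, (∑ k, if N.node k = N.node d then z k else 0) = 0) →
      ∃ g₀ g₁ : G.Dart → ZMod 2, (∀ d, g₀ (rot d) = g₀ d + z (rot d)) ∧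
        (∀ d, g₁ (N.turn d) = g₁ d + z (N.turn d)) ∧ ∀ d, g₁ d = g₀ d + twist d * z d) :
    LinkSystem G where
  rot := N.uncrossPerm * rot * N.uncrossPerm
  link := N.link
  twist d := twist (N.uncross d)
  Crossed := N.Crossed
  rot_fst d := by
    change (N.uncross (rot (N.uncross d))).fst = _
    rw [uncross_fst, rot_fst, uncross_fst]
  rot_ne d h := by
    change N.uncross (rot (N.uncross d)) = d at h
    refine rot_ne (N.uncross d) ?_
    rw [← N.uncross_uncross (rot _), h]
  link_of_not_crossed _ := N.link_of_not_crossed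
  crossed_link := N.crossed_link
  link_link d hd := by
    rw [N.link_of_crossed ((N.crossed_link d).2 hd), N.link_of_crossed hd]
    exact hd.1
  link_fst d hd := by
    rw [N.link_of_crossed hd]
    exact hd.2 d rfl
  exists_coloring z hv h1 h2 := by
    have huu := N.uncross_uncross
    obtain ⟨g₀, g₁, k0, k1, k2⟩ := exists_coloring (fun d => z (N.uncross d))
      (fun v => by
        refine Eq.trans (Finset.sum_congr rfl fun d _ => ?_)
          ((Equiv.sum_comp N.uncrossPerm _).trans (hv v))
        change _ = if (N.uncross d).fst = v then z (N.uncross d) else 0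
        rw [N.uncross_fst])
      (fun d => by
        refine Eq.trans (Finset.sum_congr rfl fun k _ => ?_)
          ((Equiv.sum_comp N.uncrossPerm _).trans (N.sum_node_eq_zero h1 h2 d))
        change _ = if N.node (N.uncross k) = N.node d then z (N.uncross k) else 0
        rw [N.node_uncross])
    refine ⟨fun d => g₀ (N.uncross d), fun d => g₁ (N.uncross d), fun d => ?_, fun d => ?_,
      fun d => ?_⟩ <;> beta_reduce
    · change g₀ (N.uncross (N.uncross (rot (N.uncross d)))) =
        g₀ (N.uncross d) + z (N.uncross (rot (N.uncross d)))
      rw [huu, k0]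
    · by_cases hd : N.Crossed d
      · have ht := (N.crossed_turn d).2 hd
        rw [N.link_of_crossed hd, N.uncross_of_crossed hd, N.uncross_of_crossed ht, k1,
          N.uncross_of_crossed ht]
      · rw [N.link_of_not_crossed hd, h1 d hd]
        rcases N.turn_uncross hd with h | h
        · rw [← h, k1, h, huu, h1 d hd]
        · rw [← h, k1, h, huu, add_assoc, CharTwo.add_self_eq_zero, add_zero]
    · rw [k2, huu]

end NodeRotation

section

open Set Filter Topology

/-- Along a path avoiding `w`, the ratio `(w - γ 1) / (w - γ 0)` has a square root that depends
continuously on `w`. -/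
theorem exists_continuousOn_sqrt_sub_div_sub (γ : C(unitInterval, ℂ)) :
    ∃ Y : ℂ → ℂ, ContinuousOn Y (range γ)ᶜ ∧
      ∀ w ∉ range γ, Y w ^ 2 = (w - γ 1) / (w - γ 0) := by
  have hne : ∀ (w : ((range γ)ᶜ : Set ℂ)) (t : unitInterval), (w : ℂ) - γ t ≠ 0 :=
    fun w t h => w.2 ⟨t, (sub_eq_zero.1 h).symm⟩
  let K : C(unitInterval × ((range γ)ᶜ : Set ℂ), {z : ℂ // z ≠ 0}) :=
    ⟨fun x => ⟨((x.2 : ℂ) - γ x.1) / ((x.2 : ℂ) - γ 0), div_ne_zero (hne _ _) (hne _ _)⟩, by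
      refine Continuous.subtype_mk (Continuous.div ?_ ?_ fun x => hne _ _) _ <;> fun_prop⟩
  have h0 : ∀ a, K (0, a) = ⟨_, ((0 : C(((range γ)ᶜ : Set ℂ), ℂ)) a).exp_ne_zero⟩ := by
    intro a
    apply Subtype.ext
    simp [K, div_self (hne a 0)]
  let L := Complex.isCoveringMap_exp.liftHomotopy K 0 h0
  have hL : ∀ x, Complex.exp (L x) = K x := fun x =>
    congrArg Subtype.val (congrFun (Complex.isCoveringMap_exp.liftHomotopy_lifts K 0 h0) x)
  classical
  refine ⟨fun w => if h : w ∉ range γ then Complex.exp (L (1, ⟨w, h⟩) / 2) else 0, ?_, ?_⟩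
  · rw [continuousOn_iff_continuous_domRestrict]
    have : Continuous fun w : ((range γ)ᶜ : Set ℂ) => Complex.exp (L (1, w) / 2) := by fun_prop
    refine this.congr fun w => ?_
    have hw : (w : ℂ) ∉ range γ := w.2
    simp only [domRestrict_apply, dif_pos hw]
  · intro w hw
    have := hL (1, ⟨w, hw⟩)
    simp only [dif_pos hw, ← Complex.exp_nat_mul]
    rw [show ((2 : ℕ) : ℂ) * (L (1, ⟨w, hw⟩) / 2) = L (1, ⟨w, hw⟩) by push_cast; ring, this]
    rfl

/-- The branch `exp (log w / 2)` of the square root. -/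
noncomputable def principalSqrt (w : ℂ) : ℂ := Complex.exp (Complex.log w / 2)

theorem principalSqrt_sq {w : ℂ} (hw : w ≠ 0) : principalSqrt w ^ 2 = w := by
  rw [principalSqrt, ← Complex.exp_nat_mul, Nat.cast_two, mul_div_cancel₀ _ two_ne_zero,
    Complex.exp_log hw]

theorem principalSqrt_ne_zero (w : ℂ) : principalSqrt w ≠ 0 := Complex.exp_ne_zero _

theorem continuousAt_principalSqrt {w : ℂ} (hw : w ∈ Complex.slitPlane) :
    ContinuousAt principalSqrt w :=
  Complex.continuous_exp.continuousAt.comp ((continuousAt_clog hw).div_const 2)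

/-- The principal square root changes its sign across the negative real axis. -/
theorem exists_tendsto_principalSqrt {w : ℂ} (hre : w.re < 0) (him : w.im = 0) :
    ∃ L : ℂ, L ≠ 0 ∧ Tendsto principalSqrt (𝓝[{z : ℂ | 0 ≤ z.im}] w) (𝓝 L) ∧
      Tendsto principalSqrt (𝓝[{z : ℂ | z.im < 0}] w) (𝓝 (-L)) := by
  refine ⟨_, Complex.exp_ne_zero _, (Complex.continuous_exp.tendsto _).comp
    ((Complex.tendsto_log_nhdsWithin_im_nonneg_of_re_neg_of_im_zero hre him).div_const 2), ?_⟩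
  have hneg : -Complex.exp ((Real.log ‖w‖ + Real.pi * Complex.I) / 2) =
      Complex.exp ((Real.log ‖w‖ - Real.pi * Complex.I) / 2) := by
    rw [← Complex.exp_sub_pi_mul_I]
    congr 1
    ring
  rw [hneg]
  exact (Complex.continuous_exp.tendsto _).comp
    ((Complex.tendsto_log_nhdsWithin_im_neg_of_re_neg_of_im_zero hre him).div_const 2)

/-- Finitely many items, each attached to a point and carrying an angle, can be rotated cyclically
around the points: every item is sent to the next one in counterclockwise order. -/
theorem exists_rotation {A P : Type*} [Fintype A] [DecidableEq A] [DecidableEq P] (pt : A → P)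
    (θ : A → ℝ) (hθ : ∀ a, θ a ∈ Ioc (-Real.pi) Real.pi)
    (inj : ∀ a b, pt a = pt b → θ a = θ b → a = b) :
    ∃ ρ : Equiv.Perm A, (∀ p, ρ.IsCycleOn {a | pt a = p}) ∧
      ∀ a, ∃ k : ℤ, θ a < θ (ρ a) + k * (2 * Real.pi) ∧
        ∀ b, pt b = pt a → ∀ j : ℤ, θ b + j * (2 * Real.pi) ∉
          Ioo (θ a) (θ (ρ a) + k * (2 * Real.pi)) := by
  classical
  let L : P → List A := fun p =>
    (Finset.univ.filter fun a => pt a = p).toList.insertionSort fun a b => θ a ≤ θ b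
  have hmem : ∀ p a, a ∈ L p ↔ pt a = p := by
    intro p a
    simp [L]
  have hnd : ∀ p, (L p).Nodup := fun p =>
    (List.perm_insertionSort _ _).nodup_iff.2 (Finset.nodup_toList _)
  have hsort : ∀ p (i j : ℕ) (hi : i < (L p).length) (hj : j < (L p).length), i < j →
      θ (L p)[i] < θ (L p)[j] := by
    intro p i j hi hj hij
    have h1 : (L p).Pairwise fun a b => θ a ≤ θ b := by
      have : Std.Total fun a b : A => θ a ≤ θ b := ⟨fun a b => le_total _ _⟩
      have : IsTrans A fun a b => θ a ≤ θ b := ⟨fun a b c => le_trans⟩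
      exact List.pairwise_insertionSort _ _
    refine lt_of_le_of_ne (List.pairwise_iff_getElem.1 h1 i j hi hj hij) fun h => ?_
    have h2 := inj _ _ (((hmem p _).1 (List.getElem_mem hi)).trans
      ((hmem p _).1 (List.getElem_mem hj)).symm) h
    exact hij.ne ((hnd p).getElem_inj_iff.1 h2)
  have hpt : ∀ p a, pt ((L p).formPerm a) = p ↔ pt a = p := by
    intro p a
    rw [← hmem, ← hmem, List.formPerm_mem_iff_mem]
  have hpt' : ∀ p a, pt ((L p).formPerm.symm a) = p ↔ pt a = p := by
    intro p a
    rw [← hpt, Equiv.apply_symm_apply]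
  let ρ : Equiv.Perm A :=
    { toFun := fun a => (L (pt a)).formPerm a
      invFun := fun a => (L (pt a)).formPerm.symm a
      left_inv := fun a => by
        simp only [(hpt (pt a) a).2 rfl, Equiv.symm_apply_apply]
      right_inv := fun a => by
        simp only [(hpt' (pt a) a).2 rfl, Equiv.apply_symm_apply] }
  have hρ : ∀ a, ρ a = (L (pt a)).formPerm a := fun a => rfl
  refine ⟨ρ, fun p => ?_, fun a => ?_⟩
  · have hc := (hnd p).isCycleOn_formPerm
    have hs : {a | a ∈ L p} = {a | pt a = p} := by ext a; simp [hmem]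
    rw [hs] at hc
    have heq : ∀ a, pt a = p → ρ a = (L p).formPerm a := by
      rintro a rfl
      rfl
    have hpow : ∀ (n : ℕ) a, pt a = p → (ρ ^ n) a = ((L p).formPerm ^ n) a ∧
        pt ((ρ ^ n) a) = p := by
      intro n
      induction n with
      | zero => intro a ha; simp [ha]
      | succ n ih =>
        intro a ha
        obtain ⟨h1, h2⟩ := ih a ha
        rw [pow_succ', pow_succ', Equiv.Perm.mul_apply, Equiv.Perm.mul_apply, heq _ h2, ← h1]
        exact ⟨rfl, (hpt p _).2 h2⟩
    refine ⟨(Set.BijOn.congr hc.1 fun a ha => (heq a ha).symm), fun a ha b hb => ?_⟩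
    obtain ⟨n, hn⟩ := (hc.2 ha hb).exists_nat_pow_eq
    exact ⟨n, by rw [zpow_natCast, (hpow n a ha).1, hn]⟩
  · have ha : a ∈ L (pt a) := (hmem _ _).2 rfl
    obtain ⟨i, hi, hia⟩ := List.getElem_of_mem ha
    have hnext : ρ a = (L (pt a))[(i + 1) % (L (pt a)).length]'(Nat.mod_lt _ (by omega)) := by
      have h := List.formPerm_apply_getElem _ (hnd (pt a)) i hi
      rw [hia] at h
      rw [hρ]
      exact h
    have hget : ∀ b, pt b = pt a → ∃ (m : ℕ) (hm : m < (L (pt a)).length),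
        (L (pt a))[m] = b := fun b hb => List.getElem_of_mem ((hmem _ _).2 hb)
    have hpi := Real.pi_pos
    by_cases hlast : i + 1 < (L (pt a)).length
    · simp only [Nat.mod_eq_of_lt hlast] at hnext
      refine ⟨0, ?_, ?_⟩
      · rw [hnext]
        conv_lhs => rw [← hia]
        simpa using hsort _ i (i + 1) hi hlast (by omega)
      · rintro b hb j ⟨h1, h2⟩
        have ba := hθ a
        have bb := hθ b
        have bc := hθ (ρ a)
        simp only [Int.cast_zero, zero_mul, add_zero] at h2
        have hj : j = 0 := by
          have l1 : (j : ℝ) < 1 := by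
            by_contra! h
            nlinarith [bb.1, bc.2]
          have l2 : (-1 : ℝ) < j := by
            by_contra! h
            nlinarith [bb.2, ba.1]
          have l3 : j < 1 := by exact_mod_cast l1
          have l4 : -1 < j := by exact_mod_cast l2
          omega
        subst hj
        simp only [Int.cast_zero, zero_mul, add_zero] at h1 h2
        obtain ⟨m, hm, rfl⟩ := hget b hb
        have m1 : i < m := by
          by_contra! h
          rcases h.lt_or_eq with h | h
          · have := hsort _ m i hm hi h
            rw [hia] at this
            linarith
          · subst h
            rw [hia] at h1
            exact lt_irrefl _ h1
        have m2 : m < i + 1 := by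
          by_contra! h
          rw [hnext] at h2
          rcases h.lt_or_eq with h | h
          · have := hsort _ (i + 1) m hlast hm h
            linarith
          · subst h
            exact lt_irrefl _ h2
        omega
    · have hil : i + 1 = (L (pt a)).length := by omega
      simp only [hil, Nat.mod_self] at hnext
      refine ⟨1, ?_, ?_⟩
      · have ba := hθ a
        have bc := hθ (ρ a)
        simp only [Int.cast_one, one_mul]
        linarith [ba.2, bc.1]
      · rintro b hb j ⟨h1, h2⟩
        have ba := hθ a
        have bb := hθ b
        have bc := hθ (ρ a)
        simp only [Int.cast_one, one_mul] at h2
        obtain ⟨m, hm, rfl⟩ := hget b hb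
        have m1 : θ (L (pt a))[m] ≤ θ a := by
          rcases Nat.lt_or_ge m i with h | h
          · have := hsort _ m i hm hi h
            rw [hia] at this
            exact this.le
          · have : m = i := by omega
            subst this
            rw [hia]
        have m2 : θ (ρ a) ≤ θ (L (pt a))[m] := by
          rw [hnext]
          rcases Nat.eq_zero_or_pos m with h | h
          · subst h
            exact le_rfl
          · exact (hsort _ 0 m (by omega) hm h).le
        have l1 : (j : ℝ) < 1 := by
          by_contra! h
          nlinarith
        have l2 : (0 : ℝ) < j := by
          by_contra! h
          nlinarith
        have l3 : j < 1 := by exact_mod_cast l1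
        have l4 : 0 < j := by exact_mod_cast l2
        omega

/-- Finitely many curves joining points of the plane that start radially on small circles around
the points, together with a branch `root h` of `√((w - pt (h, false)) * (w - pt (h, true)))` off
the curve `h` whose sign changes when the curve is crossed on one of these circles. -/
structure BranchSystem (H : Type*) where
  pt : H × Bool → ℂ
  dir : H × Bool → ℝ
  radius : ℝ
  curve : H → Set ℂ
  core : H → Set ℂ
  root : H → ℂ → ℂ
  dir_mem : ∀ a, dir a ∈ Ioc (-Real.pi) Real.pi
  dir_inj : ∀ a b, pt a = pt b → dir a = dir b → a = b
  circle_avoids : ∀ a θ b, circleMap (pt a) radius θ ≠ pt b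
  circle_curve : ∀ a θ k, circleMap (pt a) radius θ ∈ curve k →
    ∃ i, pt (k, i) = pt a ∧ ∃ j : ℤ, θ = dir (k, i) + j * (2 * Real.pi)
  curve_inter : ∀ h k w, h ≠ k → w ∈ curve h → w ∈ curve k → w ∈ range pt
  core_isPreconnected : ∀ h, IsPreconnected (core h)
  core_subset : ∀ h, core h ⊆ curve h
  core_avoids : ∀ h b, pt b ∉ core h
  probe_mem : ∀ a, circleMap (pt a) radius (dir a) ∈ core a.1
  root_sq : ∀ h, ∀ w ∉ curve h, root h w ^ 2 = (w - pt (h, false)) * (w - pt (h, true))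
  continuousAt_root : ∀ h, ∀ w ∉ curve h, ContinuousAt (root h) w
  root_flip : ∀ a, ∃ L : ℂ,
    Tendsto (fun θ => root a.1 (circleMap (pt a) radius θ)) (𝓝[>] dir a) (𝓝 L) ∧
    Tendsto (fun θ => root a.1 (circleMap (pt a) radius θ)) (𝓝[<] dir a) (𝓝 (-L))

theorem eq_of_mem_isPreconnected {f : ℂ → ℂ} {E : Set ℂ} (hE : IsPreconnected E)
    (hf : ContinuousOn f E) (hsq : ∀ w ∈ E, f w ^ 2 = 1) {x y : ℂ} (hx : x ∈ E) (hy : y ∈ E) :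
    f x = f y := by
  rcases hE.eq_one_or_eq_neg_one_of_sq_eq hf hsq with h | h
  · rw [h hx, h hy]; rfl
  · rw [h hx, h hy]; rfl

namespace BranchSystem

variable {H : Type*} {B : BranchSystem H}

theorem circleMap_notMem_range (a : H × Bool) (θ : ℝ) :
    circleMap (B.pt a) B.radius θ ∉ range B.pt := by
  rintro ⟨b, hb⟩
  exact B.circle_avoids a θ b hb.symm

theorem core_notMem_range {h : H} {w : ℂ} (hw : w ∈ B.core h) : w ∉ range B.pt := by
  rintro ⟨b, rfl⟩
  exact B.core_avoids h b hw

theorem core_notMem_curve {h k : H} (hk : k ≠ h) {w : ℂ} (hw : w ∈ B.core h) :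
    w ∉ B.curve k := fun h' =>
  core_notMem_range hw (B.curve_inter k h w hk h' (B.core_subset h hw))

theorem eventually_notMem_curve (a : H × Bool) :
    ∀ᶠ θ in 𝓝[>] B.dir a, circleMap (B.pt a) B.radius θ ∉ B.curve a.1 := by
  have h : ∀ i : Bool, ∀ᶠ θ in 𝓝[>] B.dir a,
      ¬∃ j : ℤ, θ = B.dir (a.1, i) + j * (2 * Real.pi) := by
    intro i
    have hpi := Real.pi_pos
    have h1 : Ioo (B.dir a) (B.dir (a.1, i) +
        (⌊(B.dir a - B.dir (a.1, i)) / (2 * Real.pi)⌋ + 1) * (2 * Real.pi)) ∈ 𝓝[>] B.dir a := by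
      refine Ioo_mem_nhdsGT ?_
      have := Int.lt_floor_add_one ((B.dir a - B.dir (a.1, i)) / (2 * Real.pi))
      rw [div_lt_iff₀ (by positivity)] at this
      linarith
    filter_upwards [h1] with θ hθ
    rintro ⟨j, rfl⟩
    have h2 : ⌊(B.dir a - B.dir (a.1, i)) / (2 * Real.pi)⌋ < j := by
      rw [Int.floor_lt, div_lt_iff₀ (by positivity)]
      linarith [hθ.1]
    have h3 : (j : ℝ) < ⌊(B.dir a - B.dir (a.1, i)) / (2 * Real.pi)⌋ + 1 := by
      have := hθ.2
      rwa [add_lt_add_iff_left, mul_lt_mul_iff_left₀ (by positivity)] at this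
    have h4 : j < ⌊(B.dir a - B.dir (a.1, i)) / (2 * Real.pi)⌋ + 1 := by exact_mod_cast h3
    omega
  filter_upwards [h true, h false] with θ h1 h2 h3
  obtain ⟨i, -, hi⟩ := B.circle_curve a θ a.1 h3
  cases i
  · exact h2 hi
  · exact h1 hi

variable (B) [Fintype H]

/-- The number of ends at `p` of curves in `S`. -/
noncomputable def endCount (S : Finset H) (p : ℂ) : ℕ :=
  by classical exact ((S ×ˢ (Finset.univ : Finset Bool)).filter fun a => B.pt a = p).card

/-- The product of the branches over `S`, normalised to take the values `1` and `-1`. -/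
noncomputable def partialSign (S U : Finset H) (w : ℂ) : ℂ :=
  by classical exact (∏ k ∈ U, B.root k w) /
    ∏ p ∈ Finset.univ.image B.pt, (w - p) ^ (B.endCount S p / 2)

variable {B}

theorem denominator_sq {S : Finset H} (hS : ∀ p, Even (B.endCount S p)) (w : ℂ) :
    (by classical exact ∏ p ∈ Finset.univ.image B.pt, (w - p) ^ (B.endCount S p / 2) : ℂ) ^ 2 =
      ∏ k ∈ S, ((w - B.pt (k, false)) * (w - B.pt (k, true))) := by
  classical
  have h1 : ∏ k ∈ S, ((w - B.pt (k, false)) * (w - B.pt (k, true))) =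
      ∏ a ∈ S ×ˢ (Finset.univ : Finset Bool), (w - B.pt a) := by
    rw [Finset.prod_product]
    refine Finset.prod_congr rfl fun k _ => ?_
    rw [Fintype.prod_bool, mul_comm]
  rw [h1, ← Finset.prod_fiberwise_of_maps_to (t := Finset.univ.image B.pt)
    (fun a _ => Finset.mem_image_of_mem _ (Finset.mem_univ a)), ← Finset.prod_pow]
  refine Finset.prod_congr rfl fun p _ => ?_
  rw [← pow_mul, Nat.div_mul_cancel (hS p).two_dvd]
  rw [Finset.prod_congr rfl fun a ha => by rw [(Finset.mem_filter.1 ha).2], Finset.prod_const,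
    endCount]

theorem continuousAt_partialSign (S : Finset H) {U : Finset H} {w : ℂ} (hw : w ∉ range B.pt)
    (hU : ∀ k ∈ U, w ∉ B.curve k) : ContinuousAt (B.partialSign S U) w := by
  classical
  refine ContinuousAt.div ?_ ?_ ?_
  · exact tendsto_finsetProd _ fun k hk => B.continuousAt_root k w (hU k hk)
  · fun_prop
  · refine Finset.prod_ne_zero_iff.2 fun p hp => pow_ne_zero _ (sub_ne_zero.2 ?_)
    rintro rfl
    obtain ⟨a, -, ha⟩ := Finset.mem_image.1 hp
    exact hw ⟨a, ha⟩

theorem partialSign_sq {S : Finset H} (hS : ∀ p, Even (B.endCount S p)) {w : ℂ}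
    (hw : w ∉ range B.pt) (hU : ∀ k ∈ S, w ∉ B.curve k) : B.partialSign S S w ^ 2 = 1 := by
  classical
  have h := denominator_sq hS w
  rw [partialSign, div_pow, h, ← Finset.prod_pow, Finset.prod_congr rfl fun k hk =>
    B.root_sq k w (hU k hk), div_self]
  refine Finset.prod_ne_zero_iff.2 fun k _ => mul_ne_zero (sub_ne_zero.2 ?_) (sub_ne_zero.2 ?_) <;>
  · rintro rfl
    exact hw ⟨_, rfl⟩

theorem partialSign_erase_sq [DecidableEq H] {S : Finset H} (hS : ∀ p, Even (B.endCount S p))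
    {h : H} (hh : h ∈ S) {w : ℂ} (hw : w ∉ range B.pt) (hU : ∀ k ∈ S.erase h, w ∉ B.curve k) :
    B.partialSign S (S.erase h) w ^ 2 * ((w - B.pt (h, false)) * (w - B.pt (h, true))) = 1 := by
  classical
  have hd := denominator_sq hS w
  rw [partialSign, div_pow, hd, ← Finset.prod_pow, Finset.prod_congr rfl fun k hk =>
    B.root_sq k w (hU k hk), div_mul_eq_mul_div, Finset.prod_erase_mul _ _ hh, div_self]
  refine Finset.prod_ne_zero_iff.2 fun k _ => mul_ne_zero (sub_ne_zero.2 ?_) (sub_ne_zero.2 ?_) <;>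
  · rintro rfl
    exact hw ⟨_, rfl⟩

theorem partialSign_eq_root_mul [DecidableEq H] {S : Finset H} {h : H} (hh : h ∈ S) (w : ℂ) :
    B.partialSign S S w = B.root h w * B.partialSign S (S.erase h) w := by
  rw [partialSign, partialSign, ← mul_div_assoc, Finset.mul_prod_erase _ (B.root · w) hh]

variable [DecidableEq H]

/-- The right limit at the direction of `a` of the signs around `B.pt a`. -/
theorem exists_tendsto_partialSign (S : Finset H) (a : H × Bool) :
    ∃ s : ℂ, Tendsto (fun θ => B.partialSign S S (circleMap (B.pt a) B.radius θ))
        (𝓝[>] B.dir a) (𝓝 s) ∧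
      Tendsto (fun θ => B.partialSign S S (circleMap (B.pt a) B.radius θ))
        (𝓝[<] B.dir a) (𝓝 (if a.1 ∈ S then -s else s)) ∧
      (a.1 ∉ S → s = B.partialSign S S (circleMap (B.pt a) B.radius (B.dir a))) := by
  classical
  have hc : ContinuousAt (circleMap (B.pt a) B.radius) (B.dir a) :=
    (continuous_circleMap _ _).continuousAt
  have hw := B.probe_mem a
  by_cases ha : a.1 ∈ S
  · obtain ⟨L, h1, h2⟩ := B.root_flip a
    have hM : Tendsto (fun θ => B.partialSign S (S.erase a.1) (circleMap (B.pt a) B.radius θ))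
        (𝓝 (B.dir a)) (𝓝 (B.partialSign S (S.erase a.1)
          (circleMap (B.pt a) B.radius (B.dir a)))) :=
      ContinuousAt.comp (f := circleMap (B.pt a) B.radius)
        (continuousAt_partialSign S (core_notMem_range hw)
        fun k hk => core_notMem_curve (Finset.mem_erase.1 hk).1 hw) hc
    refine ⟨L * B.partialSign S (S.erase a.1) (circleMap (B.pt a) B.radius (B.dir a)), ?_, ?_,
      fun h => absurd ha h⟩
    · simp only [partialSign_eq_root_mul ha]
      exact h1.mul (hM.mono_left nhdsWithin_le_nhds)
    · simp only [partialSign_eq_root_mul ha, if_pos ha, ← neg_mul]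
      exact h2.mul (hM.mono_left nhdsWithin_le_nhds)
  · have hM : Tendsto (fun θ => B.partialSign S S (circleMap (B.pt a) B.radius θ))
        (𝓝 (B.dir a)) (𝓝 (B.partialSign S S (circleMap (B.pt a) B.radius (B.dir a)))) :=
      ContinuousAt.comp (f := circleMap (B.pt a) B.radius)
        (continuousAt_partialSign S (core_notMem_range hw)
        fun k hk => core_notMem_curve (by rintro rfl; exact ha hk) hw) hc
    refine ⟨_, hM.mono_left nhdsWithin_le_nhds, ?_, fun _ => rfl⟩
    rw [if_neg ha]
    exact hM.mono_left nhdsWithin_le_nhds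

/-- The sign of the sector that follows the end `a` counterclockwise. -/
noncomputable def sectorSign (B : BranchSystem H) (S : Finset H) (a : H × Bool) : ℂ :=
  (exists_tendsto_partialSign (B := B) S a).choose

theorem tendsto_sectorSign (S : Finset H) (a : H × Bool) :
    Tendsto (fun θ => B.partialSign S S (circleMap (B.pt a) B.radius θ))
      (𝓝[>] B.dir a) (𝓝 (B.sectorSign S a)) :=
  (exists_tendsto_partialSign (B := B) S a).choose_spec.1

theorem tendsto_sectorSign_left (S : Finset H) (a : H × Bool) :
    Tendsto (fun θ => B.partialSign S S (circleMap (B.pt a) B.radius θ))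
      (𝓝[<] B.dir a) (𝓝 (if a.1 ∈ S then -B.sectorSign S a else B.sectorSign S a)) :=
  (exists_tendsto_partialSign (B := B) S a).choose_spec.2.1

theorem sectorSign_of_notMem (S : Finset H) {a : H × Bool} (ha : a.1 ∉ S) :
    B.sectorSign S a = B.partialSign S S (circleMap (B.pt a) B.radius (B.dir a)) :=
  (exists_tendsto_partialSign (B := B) S a).choose_spec.2.2 ha

theorem sectorSign_false_eq_true {S : Finset H} (hS : ∀ p, Even (B.endCount S p)) {h : H}
    (hh : h ∉ S) : B.sectorSign S (h, false) = B.sectorSign S (h, true) := by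
  rw [sectorSign_of_notMem S (a := (h, false)) hh, sectorSign_of_notMem S (a := (h, true)) hh]
  have hne : ∀ k ∈ S, k ≠ h := by
    rintro k hk rfl
    exact hh hk
  refine eq_of_mem_isPreconnected (B.core_isPreconnected h) (fun w hw => ?_) (fun w hw => ?_)
    (B.probe_mem (h, false)) (B.probe_mem (h, true))
  · exact (continuousAt_partialSign S (core_notMem_range hw)
      fun k hk => core_notMem_curve (hne k hk) hw).continuousWithinAt
  · exact partialSign_sq hS (core_notMem_range hw) fun k hk => core_notMem_curve (hne k hk) hw

theorem sectorSign_mul_eq {S S' : Finset H} (hS : ∀ p, Even (B.endCount S p))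
    (hS' : ∀ p, Even (B.endCount S' p)) {h : H} (hh : h ∈ S) (hh' : h ∈ S') :
    B.sectorSign S (h, false) * B.sectorSign S' (h, false) =
      B.sectorSign S (h, true) * B.sectorSign S' (h, true) := by
  classical
  let K : ℂ → ℂ := fun w => (w - B.pt (h, false)) * (w - B.pt (h, true)) *
    (B.partialSign S (S.erase h) w * B.partialSign S' (S'.erase h) w)
  have hcont : ∀ w ∈ B.core h, ContinuousAt K w := by
    intro w hw
    refine ContinuousAt.mul (by fun_prop) (ContinuousAt.mul ?_ ?_) <;>
    · exact continuousAt_partialSign _ (core_notMem_range hw)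
        fun k hk => core_notMem_curve (Finset.mem_erase.1 hk).1 hw
  have key : ∀ i, B.sectorSign S (h, i) * B.sectorSign S' (h, i) =
      K (circleMap (B.pt (h, i)) B.radius (B.dir (h, i))) := by
    intro i
    refine tendsto_nhds_unique
      ((tendsto_sectorSign S (h, i)).mul (tendsto_sectorSign S' (h, i))) ?_
    have h1 : Tendsto (fun θ => K (circleMap (B.pt (h, i)) B.radius θ)) (𝓝[>] B.dir (h, i))
        (𝓝 (K (circleMap (B.pt (h, i)) B.radius (B.dir (h, i))))) :=
      (ContinuousAt.comp (f := circleMap (B.pt (h, i)) B.radius) (hcont _ (B.probe_mem (h, i)))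
        (continuous_circleMap _ _).continuousAt).tendsto.mono_left nhdsWithin_le_nhds
    refine h1.congr' ?_
    filter_upwards [eventually_notMem_curve (B := B) (h, i)] with θ hθ
    have := B.root_sq h _ hθ
    simp only [K]
    rw [← this, partialSign_eq_root_mul hh, partialSign_eq_root_mul hh']
    ring
  rw [key, key]
  refine eq_of_mem_isPreconnected (B.core_isPreconnected h)
    (fun w hw => (hcont w hw).continuousWithinAt) (fun w hw => ?_)
    (B.probe_mem (h, false)) (B.probe_mem (h, true))
  have h1 := partialSign_erase_sq hS hh (core_notMem_range hw)
    fun k hk => core_notMem_curve (Finset.mem_erase.1 hk).1 hw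
  have h2 := partialSign_erase_sq hS' hh' (core_notMem_range hw)
    fun k hk => core_notMem_curve (Finset.mem_erase.1 hk).1 hw
  simp only [K]
  calc _ = (B.partialSign S (S.erase h) w ^ 2 *
          ((w - B.pt (h, false)) * (w - B.pt (h, true)))) *
        (B.partialSign S' (S'.erase h) w ^ 2 *
          ((w - B.pt (h, false)) * (w - B.pt (h, true)))) := by ring
    _ = 1 := by rw [h1, h2, one_mul]

theorem sectorSign_next {S : Finset H} (hS : ∀ p, Even (B.endCount S p))
    {a b : H × Bool} (hab : B.pt a = B.pt b) {k : ℤ}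
    (hlt : B.dir a < B.dir b + k * (2 * Real.pi))
    (hgap : ∀ c, B.pt c = B.pt a → ∀ j : ℤ, B.dir c + j * (2 * Real.pi) ∉
      Ioo (B.dir a) (B.dir b + k * (2 * Real.pi))) :
    B.sectorSign S a ^ 2 = 1 ∧
      B.sectorSign S b = if b.1 ∈ S then -B.sectorSign S a else B.sectorSign S a := by
  set f : ℝ → ℂ := fun θ => B.partialSign S S (circleMap (B.pt a) B.radius θ) with hf
  have hoff : ∀ θ ∈ Ioo (B.dir a) (B.dir b + k * (2 * Real.pi)), ∀ h,
      circleMap (B.pt a) B.radius θ ∉ B.curve h := by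
    intro θ hθ h hh
    obtain ⟨i, hi, j, hj⟩ := B.circle_curve a θ h hh
    exact hgap _ hi j (hj ▸ hθ)
  have hcont : ContinuousOn f (Ioo (B.dir a) (B.dir b + k * (2 * Real.pi))) := fun θ hθ =>
    (ContinuousAt.comp (f := circleMap (B.pt a) B.radius)
      (continuousAt_partialSign S (circleMap_notMem_range a θ) fun h _ => hoff θ hθ h)
      (continuous_circleMap _ _).continuousAt).continuousWithinAt
  have hsq : EqOn (f ^ 2) 1 (Ioo (B.dir a) (B.dir b + k * (2 * Real.pi))) := fun θ hθ =>
    partialSign_sq hS (circleMap_notMem_range a θ) fun h _ => hoff θ hθ h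
  obtain ⟨s, hs2, hs⟩ : ∃ s : ℂ, s ^ 2 = 1 ∧
      ∀ θ ∈ Ioo (B.dir a) (B.dir b + k * (2 * Real.pi)), f θ = s := by
    rcases isPreconnected_Ioo.eq_one_or_eq_neg_one_of_sq_eq hcont hsq with h | h
    · exact ⟨1, by norm_num, h⟩
    · exact ⟨-1, by norm_num, h⟩
  have ha : B.sectorSign S a = s := by
    refine tendsto_nhds_unique (tendsto_sectorSign S a) (tendsto_const_nhds.congr' ?_)
    filter_upwards [Ioo_mem_nhdsGT hlt] with θ hθ
    exact (hs θ hθ).symm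
  refine ⟨by rw [ha, hs2], ?_⟩
  have hb : (if b.1 ∈ S then -B.sectorSign S b else B.sectorSign S b) = s := by
    refine tendsto_nhds_unique (tendsto_sectorSign_left S b) (tendsto_const_nhds.congr' ?_)
    filter_upwards [Ioo_mem_nhdsLT (show B.dir a - k * (2 * Real.pi) < B.dir b by linarith)]
      with θ hθ
    have h1 := hs (θ + k * (2 * Real.pi)) ⟨by linarith [hθ.1], by linarith [hθ.2]⟩
    rw [← h1, hf]
    have h2 := (periodic_circleMap (B.pt a) B.radius).int_mul k θ
    simp only [h2]
    rw [hab]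
  rw [ha, ← hb]
  split_ifs <;> simp

/-- The mod 2 cycle space of a system of curves in the plane is generated by sectors: even sets of
curves are the boundaries of two-colourings of the sectors. -/
theorem exists_rotation_twist (B : BranchSystem H) :
    ∃ (ρ : Equiv.Perm (H × Bool)) (tw : H → ZMod 2),
      (∀ p, ρ.IsCycleOn {a | B.pt a = p}) ∧
      ∀ z : H → ZMod 2, (∀ p, (∑ a, if B.pt a = p then z a.1 else 0) = 0) →
        ∃ g : H × Bool → ZMod 2, (∀ a, g (ρ a) = g a + z (ρ a).1) ∧
          ∀ h, g (h, true) = g (h, false) + tw h * z h := by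
  obtain ⟨ρ, hcyc, hgap⟩ := exists_rotation B.pt B.dir B.dir_mem B.dir_inj
  let E : Set (Finset H) := {S | ∀ p, Even (B.endCount S p)}
  let g : Finset H → H × Bool → ZMod 2 := fun S a => if B.sectorSign S a = 1 then 0 else 1
  have hpt : ∀ a, B.pt (ρ a) = B.pt a := fun a => (hcyc (B.pt a)).1.mapsTo rfl
  have hnext : ∀ S ∈ E, ∀ a, B.sectorSign S a ^ 2 = 1 ∧ B.sectorSign S (ρ a) =
      if (ρ a).1 ∈ S then -B.sectorSign S a else B.sectorSign S a := by
    intro S hS a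
    obtain ⟨k, hk, hg⟩ := hgap a
    exact sectorSign_next hS (hpt a).symm hk hg
  have hsign : ∀ S ∈ E, ∀ a, B.sectorSign S a = 1 ∨ B.sectorSign S a = -1 := fun S hS a =>
    (sq_eq_sq_iff_eq_or_eq_neg.1 <| by rw [one_pow]; exact (hnext S hS a).1)
  let tw : H → ZMod 2 := fun h =>
    by classical exact if hh : ∃ S ∈ E, h ∈ S then g hh.choose (h, true) - g hh.choose (h, false)
      else 0
  refine ⟨ρ, tw, hcyc, fun z hz => ?_⟩
  let S : Finset H := Finset.univ.filter fun h => z h = 1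
  have z01 : ∀ x : ZMod 2, x = 1 ∨ x = 0 := by decide
  have hS : S ∈ E := by
    intro p
    have h1 : (B.endCount S p : ZMod 2) = ∑ a, if B.pt a = p then z a.1 else 0 := by
      classical
      rw [endCount, Finset.card_filter, Nat.cast_sum]
      refine Eq.trans (Finset.sum_congr rfl fun a ha => ?_)
        (Finset.sum_subset (Finset.subset_univ (S ×ˢ Finset.univ)) fun a _ ha => ?_)
      · have : a.1 ∈ S := (Finset.mem_product.1 ha).1
        rw [(Finset.mem_filter.1 this).2]
        split_ifs <;> simp
      · have : z a.1 = 0 := (z01 _).resolve_left fun h => ha (by simp [S, h])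
        rw [this, ite_self]
    rw [← ZMod.natCast_eq_zero_iff_even, h1, hz]
  refine ⟨g S, fun a => ?_, fun h => ?_⟩
  · obtain ⟨-, h1⟩ := hnext S hS a
    have h2 := hsign S hS a
    simp only [g]
    rcases z01 (z (ρ a).1) with h | h
    · have hm : (ρ a).1 ∈ S := by simp [S, h]
      rw [if_pos hm] at h1
      rcases h2 with h2 | h2 <;> rw [h1, h2, h] <;> norm_num
      decide
    · have hm : (ρ a).1 ∉ S := by simp [S, h]
      rw [if_neg hm] at h1
      rw [h1, h, add_zero]
  · rcases z01 (z h) with hz' | hz'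
    · have hh : h ∈ S := by simp [S, hz']
      have hex : ∃ S ∈ E, h ∈ S := ⟨S, hS, hh⟩
      have htw : tw h = g hex.choose (h, true) - g hex.choose (h, false) := dif_pos hex
      obtain ⟨hS', hh'⟩ := hex.choose_spec
      have h1 := sectorSign_mul_eq hS hS' hh hh'
      rw [htw, hz']
      simp only [g]
      rcases hsign S hS (h, false) with a1 | a1 <;> rcases hsign S hS (h, true) with a2 | a2 <;>
      rcases hsign _ hS' (h, false) with a3 | a3 <;>
      rcases hsign _ hS' (h, true) with a4 | a4 <;>
      rw [a1, a2, a3, a4] at h1 <;> rw [a1, a2, a3, a4] <;>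
      first | (exfalso; norm_num at h1; done) | (clear h1; norm_num; done) |
        (clear h1; norm_num; decide)
    · have hh : h ∉ S := by simp [S, hz']
      simp only [g]
      rw [sectorSign_false_eq_true hS hh, hz', mul_zero, add_zero]

end BranchSystem

theorem exists_last_crossing {f : ℝ → ℝ} {a b r : ℝ} (hab : a ≤ b) (hf : ContinuousOn f (Icc a b))
    (ha : f a < r) (hb : r < f b) : ∃ t ∈ Ioo a b, f t = r ∧ ∀ s ∈ Ioc t b, r < f s := by
  have hK : IsCompact {t ∈ Icc a b | f t ≤ r} := by
    have := hf.preimage_isClosed_of_isClosed isClosed_Icc (isClosed_Iic (a := r))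
    exact isCompact_Icc.of_isClosed_subset this inter_subset_left
  obtain ⟨t, ⟨⟨hta, htb⟩, htr⟩, hmax⟩ := hK.exists_isGreatest ⟨a, ⟨le_rfl, hab⟩, ha.le⟩
  have hlt : ∀ s ∈ Ioc t b, r < f s := by
    intro s hs
    by_contra! h
    exact hs.1.not_ge (hmax ⟨⟨hta.trans hs.1.le, hs.2⟩, h⟩)
  have heq : f t = r := by
    by_contra hne
    obtain ⟨s, hs, hsr⟩ := intermediate_value_Icc htb
      (hf.mono (Icc_subset_Icc hta le_rfl)) ⟨htr, hb.le⟩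
    rcases hs.1.eq_or_lt with h | h
    · exact hne (h ▸ hsr)
    · exact (hlt s ⟨h, hs.2⟩).ne' hsr
  refine ⟨t, ⟨hta.lt_of_ne ?_, htb.lt_of_ne ?_⟩, heq, hlt⟩
  · rintro rfl
    exact ha.ne heq
  · rintro rfl
    exact hb.ne' heq

theorem exists_first_crossing {f : ℝ → ℝ} {a b r : ℝ} (hab : a ≤ b) (hf : ContinuousOn f (Icc a b))
    (ha : r < f a) (hb : f b < r) : ∃ t ∈ Ioo a b, f t = r ∧ ∀ s ∈ Ico a t, r < f s := by
  obtain ⟨t, ht, h1, h2⟩ := exists_last_crossing (f := fun x => f (a + b - x)) hab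
    (hf.comp (by fun_prop) fun x hx => ⟨by linarith [hx.2], by linarith [hx.1]⟩)
    (show f (a + b - a) < r by rwa [add_sub_cancel_left])
    (show r < f (a + b - b) by rwa [add_sub_cancel_right])
  refine ⟨a + b - t, ⟨by linarith [ht.2], by linarith [ht.1]⟩, h1, fun s hs => ?_⟩
  have := h2 (a + b - s) ⟨by linarith [hs.2], by linarith [hs.1]⟩
  simpa using this

/-- An arc has a middle part that leaves two disjoint discs around its ends. -/
theorem exists_middle {γ : ℝ → ℂ} (hγ : ContinuousOn γ (Icc 0 1)) {r : ℝ} (hr : 0 < r)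
    (hd : 2 * r < dist (γ 0) (γ 1)) : ∃ t₀ t₁ : ℝ, 0 < t₀ ∧ t₀ < t₁ ∧ t₁ < 1 ∧
      dist (γ t₀) (γ 0) = r ∧ dist (γ t₁) (γ 1) = r ∧
      ∀ t ∈ Icc t₀ t₁, (dist (γ t) (γ 0) ≤ r → t = t₀) ∧ (dist (γ t) (γ 1) ≤ r → t = t₁) := by
  obtain ⟨t₀, h0, e0, l0⟩ := exists_last_crossing (f := fun t => dist (γ t) (γ 0)) zero_le_one
    (continuous_dist.comp_continuousOn (hγ.prodMk continuousOn_const)) (by simpa using hr) (by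
      rw [dist_comm]
      linarith)
  obtain ⟨t₁, h1, e1, l1⟩ := exists_first_crossing (f := fun t => dist (γ t) (γ 1)) h0.2.le
    ((continuous_dist.comp_continuousOn (hγ.prodMk continuousOn_const)).mono
      (Icc_subset_Icc h0.1.le le_rfl)) (show r < dist (γ t₀) (γ 1) by
      have := dist_triangle (γ 0) (γ t₀) (γ 1)
      rw [dist_comm (γ 0) (γ t₀), e0] at this
      linarith) (by simpa using hr)
  refine ⟨t₀, t₁, h0.1, h1.1, h1.2, e0, e1, fun t ht => ⟨fun h => ?_, fun h => ?_⟩⟩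
  · by_contra hne
    exact (l0 t ⟨ht.1.lt_of_ne (Ne.symm hne), ht.2.trans h1.2.le⟩).not_ge h
  · by_contra hne
    exact (l1 t ⟨ht.1, ht.2.lt_of_ne hne⟩).not_ge h

theorem dist_circleMap_center (p : ℂ) {s : ℝ} (hs : 0 ≤ s) (θ : ℝ) :
    dist (circleMap p s θ) p = s := by
  rw [dist_eq_norm, circleMap_sub_center, norm_circleMap_zero, abs_of_nonneg hs]

/-- The ratio `(w - q) / (w - p)` only meets the cut of the logarithm on the segment from `p` to
`q`. -/
theorem div_mem_slitPlane {p w : ℂ} {r φ : ℝ} (hr : 0 ≤ r) (hw : w ≠ p)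
    (hs : ∀ s ∈ Icc 0 r, w ≠ circleMap p s φ) :
    (w - circleMap p r φ) / (w - p) ∈ Complex.slitPlane := by
  by_contra h
  rw [Complex.mem_slitPlane_iff, not_or, not_lt, not_not] at h
  obtain ⟨h1, h2⟩ := h
  set u := (w - circleMap p r φ) / (w - p) with hu
  have hu' : u = ((u.re : ℝ) : ℂ) := Complex.ext rfl (by simp [h2])
  have hpos : 0 < 1 - u.re := by linarith
  refine hs (r / (1 - u.re)) ⟨by positivity, div_le_self hr (by linarith)⟩ ?_
  have h3 : w - circleMap p r φ = u * (w - p) := by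
    rw [hu, div_mul_cancel₀ _ (sub_ne_zero.2 hw)]
  have h4 : (1 - (u.re : ℂ)) ≠ 0 := by
    exact_mod_cast hpos.ne'
  rw [hu'] at h3
  simp only [circleMap] at h3 ⊢
  push_cast
  field_simp
  linear_combination h3

/-- On a small circle around `p`, the root of `(w - q) / (w - p)` changes its sign when the segment
from `p` to `q` is crossed. -/
theorem exists_tendsto_sqrt_circleMap (p : ℂ) {r : ℝ} (hr : 0 < r) (α : ℝ) : ∃ L : ℂ, L ≠ 0 ∧
    Tendsto (fun θ => principalSqrt ((circleMap p (r / 2) θ - circleMap p r α) /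
      (circleMap p (r / 2) θ - p))) (𝓝[>] α) (𝓝 L) ∧
    Tendsto (fun θ => principalSqrt ((circleMap p (r / 2) θ - circleMap p r α) /
      (circleMap p (r / 2) θ - p))) (𝓝[<] α) (𝓝 (-L)) := by
  obtain ⟨L, hL, h1, h2⟩ := exists_tendsto_principalSqrt (w := -1) (by simp) (by simp)
  have hu : ∀ θ : ℝ, (circleMap p (r / 2) θ - circleMap p r α) / (circleMap p (r / 2) θ - p) =
      1 - 2 * Complex.exp ((α - θ : ℝ) * Complex.I) := by
    intro θ
    have hr' : (r : ℂ) ≠ 0 := by exact_mod_cast hr.ne'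
    have := Complex.exp_ne_zero (θ * Complex.I)
    simp only [circleMap]
    push_cast
    rw [sub_mul, Complex.exp_sub]
    field_simp
    ring
  have him : ∀ θ : ℝ, (1 - 2 * Complex.exp ((α - θ : ℝ) * Complex.I)).im =
      2 * Real.sin (θ - α) := by
    intro θ
    simp only [Complex.sub_im, Complex.one_im, Complex.mul_im, Complex.exp_ofReal_mul_I_im,
      Complex.re_ofNat, Complex.im_ofNat]
    rw [← neg_sub α θ, Real.sin_neg]
    ring
  have hlim : Tendsto (fun θ : ℝ => 1 - 2 * Complex.exp ((α - θ : ℝ) * Complex.I)) (𝓝 α)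
      (𝓝 (-1)) := by
    have hc : Continuous fun θ : ℝ => 1 - 2 * Complex.exp ((α - θ : ℝ) * Complex.I) := by fun_prop
    convert hc.tendsto α using 2
    simp
    norm_num
  simp only [hu]
  refine ⟨L, hL, h1.comp (tendsto_nhdsWithin_iff.2 ⟨hlim.mono_left nhdsWithin_le_nhds, ?_⟩),
    h2.comp (tendsto_nhdsWithin_iff.2 ⟨hlim.mono_left nhdsWithin_le_nhds, ?_⟩)⟩
  · filter_upwards [Ioo_mem_nhdsGT (show α < α + Real.pi by linarith [Real.pi_pos])] with θ hθ
    simp only [him]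
    have := Real.sin_nonneg_of_nonneg_of_le_pi (x := θ - α) (by linarith [hθ.1])
      (by linarith [hθ.2])
    linarith
  · filter_upwards [Ioo_mem_nhdsLT (show α - Real.pi < α by linarith [Real.pi_pos])] with θ hθ
    simp only [him]
    have := Real.sin_neg_of_neg_of_neg_pi_lt (x := θ - α) (by linarith [hθ.2])
      (by linarith [hθ.1])
    linarith

/-- A radius small enough to separate finitely many points from one another and from finitely many
compact sets. -/
theorem exists_separating_radius {A H : Type*} [Finite A] [Finite H] (pt : A → ℂ)
    (K : H → Set ℂ) (hK : ∀ h, IsCompact (K h)) : ∃ r : ℝ, 0 < r ∧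
      (∀ a b, pt a ≠ pt b → 2 * r < dist (pt a) (pt b)) ∧
      ∀ h a, pt a ∉ K h → ∀ w ∈ K h, r < dist w (pt a) := by
  have h1 : ∀ᶠ r in 𝓝[>] (0 : ℝ), ∀ a b, pt a ≠ pt b → 2 * r < dist (pt a) (pt b) := by
    rw [eventually_all]; intro a
    rw [eventually_all]; intro b
    by_cases h : pt a = pt b
    · simp [h]
    · have : 0 < dist (pt a) (pt b) / 2 := half_pos (dist_pos.2 h)
      filter_upwards [Ioo_mem_nhdsGT this] with r hr _
      linarith [hr.2]
  have h2 : ∀ᶠ r in 𝓝[>] (0 : ℝ), ∀ h a, pt a ∉ K h → ∀ w ∈ K h, r < dist w (pt a) := by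
    rw [eventually_all]; intro h
    rw [eventually_all]; intro a
    by_cases ha : pt a ∈ K h
    · simp [ha]
    · obtain ⟨ε, hε, hb⟩ := Metric.mem_nhds_iff.1 ((hK h).isClosed.isOpen_compl.mem_nhds ha)
      filter_upwards [Ioo_mem_nhdsGT hε] with r hr _ w hw
      by_contra! hle
      exact hb (Metric.mem_ball.2 (hle.trans_lt hr.2)) hw
  obtain ⟨r, ⟨h1, h2⟩, h3⟩ := ((h1.and h2).and self_mem_nhdsWithin).exists
  exact ⟨r, h3, h1, h2⟩

/-- The position of an end of an arc. -/
def arcEnd {H : Type*} (γ : H → ℝ → ℂ) (a : H × Bool) : ℂ := γ a.1 (if a.2 then 1 else 0)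

/-- Arcs with disjoint interiors can be made radial around their ends, which yields a branch
system. -/
theorem exists_branchSystem {H : Type*} [Finite H] (γ : H → ℝ → ℂ)
    (hγ : ∀ h, ContinuousOn (γ h) (Icc 0 1)) (hinj : ∀ h, InjOn (γ h) (Icc 0 1))
    (hdisj : ∀ h k, h ≠ k → ∀ t ∈ Ioo (0 : ℝ) 1, ∀ s ∈ Icc (0 : ℝ) 1, γ h t ≠ γ k s) :
    ∃ B : BranchSystem H, B.pt = arcEnd γ := by
  have mem01 : ∀ i : Bool, (if i then 1 else 0 : ℝ) ∈ Icc (0 : ℝ) 1 := by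
    intro i
    cases i <;> simp
  obtain ⟨r, hr, hsep, havoid⟩ := exists_separating_radius (arcEnd γ)
    (fun h => γ h '' Icc 0 1) fun h => isCompact_Icc.image_of_continuousOn (hγ h)
  have hends : ∀ h, γ h 0 ≠ γ h 1 := fun h he =>
    zero_ne_one (hinj h ⟨le_rfl, zero_le_one⟩ ⟨zero_le_one, le_rfl⟩ he)
  choose t₀ t₁ ht₀ ht ht₁ hd₀ hd₁ hmid using fun h =>
    exists_middle (hγ h) hr (hsep (h, false) (h, true) (hends h))
  let pt := arcEnd γ
  let time : H × Bool → ℝ := fun a => if a.2 then t₁ a.1 else t₀ a.1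
  let dir : H × Bool → ℝ := fun a => Complex.arg (γ a.1 (time a) - pt a)
  have time_mem : ∀ a, time a ∈ Icc (t₀ a.1) (t₁ a.1) := by
    rintro ⟨h, i⟩
    cases i
    · exact ⟨le_rfl, (ht h).le⟩
    · exact ⟨(ht h).le, le_rfl⟩
  have mid_sub : ∀ h, ∀ t ∈ Icc (t₀ h) (t₁ h), t ∈ Ioo (0 : ℝ) 1 := fun h t h' =>
    ⟨(ht₀ h).trans_le h'.1, h'.2.trans_lt (ht₁ h)⟩
  have tip_dist : ∀ a, dist (γ a.1 (time a)) (pt a) = r := by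
    rintro ⟨h, i⟩
    cases i
    · exact hd₀ h
    · exact hd₁ h
  have tip_eq : ∀ a, circleMap (pt a) r (dir a) = γ a.1 (time a) := by
    intro a
    rw [circleMap, ← tip_dist a, dist_eq_norm, Complex.norm_mul_exp_arg_mul_I,
      add_sub_cancel]
  have mid_inj : ∀ h k t s, t ∈ Icc (t₀ h) (t₁ h) → s ∈ Icc (t₀ k) (t₁ k) → γ h t = γ k s →
      h = k := by
    intro h k t s h1 h2 he
    by_contra hne
    exact hdisj h k hne t (mid_sub h t h1) s (Ioo_subset_Icc_self (mid_sub k s h2)) he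
  have mid_near : ∀ h, ∀ t ∈ Icc (t₀ h) (t₁ h), ∀ a, dist (γ h t) (pt a) ≤ r →
      ∃ i, pt (h, i) = pt a ∧ t = time (h, i) := by
    intro h t h1 a hle
    by_cases ha : pt a ∈ γ h '' Icc 0 1
    · obtain ⟨s, hs, hsa⟩ := ha
      have hor : s = 0 ∨ s = 1 := by
        by_contra! hne
        have hsI : s ∈ Ioo (0 : ℝ) 1 := ⟨hs.1.lt_of_ne hne.1.symm, hs.2.lt_of_ne hne.2⟩
        by_cases hk : h = a.1
        · have := hinj h hs (mem01 a.2) (hsa.trans (by rw [hk]; rfl))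
          cases hb : a.2 <;> simp [hb] at this <;> simp [this] at hne
        · exact hdisj h a.1 hk s hsI _ (mem01 a.2) hsa
      rcases hor with rfl | rfl
      · exact ⟨false, hsa, (hmid h t h1).1 (hsa.symm ▸ hle)⟩
      · exact ⟨true, hsa, (hmid h t h1).2 (hsa.symm ▸ hle)⟩
    · exact absurd hle (havoid h a ha _ ⟨t, Ioo_subset_Icc_self (mid_sub h t h1), rfl⟩).not_ge
  have spoke_near : ∀ a s θ, s ∈ Icc 0 r → ∀ b, dist (circleMap (pt a) s θ) (pt b) ≤ r →
      pt a = pt b := by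
    intro a s θ hs b hb
    by_contra hne
    have h1 := hsep a b hne
    have h2 := dist_triangle_left (pt a) (pt b) (circleMap (pt a) s θ)
    rw [dist_circleMap_center _ hs.1] at h2
    change 2 * r < dist (pt a) (pt b) at h1
    linarith [hs.2]
  have end_inj : ∀ a b, pt a = pt b → γ a.1 (time a) = γ b.1 (time b) → a = b := by
    intro a b h1 h2
    have h3 := mid_inj _ _ _ _ (time_mem a) (time_mem b) h2
    refine Prod.ext h3 ?_
    have h4 := hinj a.1 (mem01 a.2) (mem01 b.2) (h1.trans (by rw [h3]; rfl))
    cases ha : a.2 <;> cases hb : b.2 <;> simp [ha, hb] at h4 ⊢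
  let curve : H → Set ℂ := fun h =>
    {w | (∃ i, ∃ s ∈ Icc 0 r, w = circleMap (pt (h, i)) s (dir (h, i))) ∨
      ∃ t ∈ Icc (t₀ h) (t₁ h), w = γ h t}
  let spoke : H × Bool → Set ℂ := fun a => (circleMap (pt a) · (dir a)) '' Icc (r / 2) r
  let core : H → Set ℂ := fun h => spoke (h, false) ∪ γ h '' Icc (t₀ h) (t₁ h) ∪ spoke (h, true)
  have mid_cont : ∀ h, ContinuousOn (γ h) (Icc (t₀ h) (t₁ h)) := fun h =>
    (hγ h).mono fun t h' => Ioo_subset_Icc_self (mid_sub h t h')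
  have spoke_cont : ∀ a, Continuous fun s => circleMap (pt a) s (dir a) := by
    intro a
    simp only [circleMap]
    fun_prop
  have half_mem : r / 2 ∈ Icc 0 r := ⟨by linarith, by linarith⟩
  let mid : H → C(unitInterval, ℂ) := fun h =>
    ⟨fun x => γ h (t₀ h + (t₁ h - t₀ h) * x), (mid_cont h).comp_continuous (by fun_prop) fun x =>
      ⟨by nlinarith [x.2.1, ht h], by nlinarith [x.2.2, ht h]⟩⟩
  have mid_range : ∀ h, range (mid h) ⊆ curve h := by
    rintro h _ ⟨x, rfl⟩
    exact Or.inr ⟨t₀ h + (t₁ h - t₀ h) * x,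
      ⟨by nlinarith [x.2.1, ht h], by nlinarith [x.2.2, ht h]⟩, rfl⟩
  have mid_zero : ∀ h, mid h 0 = γ h (time (h, false)) := by
    intro h
    change γ h _ = _
    simp [time]
  have mid_one : ∀ h, mid h 1 = γ h (time (h, true)) := by
    intro h
    change γ h _ = _
    simp [time]
  choose Y hYc hYs using fun h => exists_continuousOn_sqrt_sub_div_sub (mid h)
  let R : H × Bool → ℂ → ℂ := fun a w =>
    principalSqrt ((w - circleMap (pt a) r (dir a)) / (w - pt a))
  have R_cont : ∀ a w, (∀ s ∈ Icc 0 r, w ≠ circleMap (pt a) s (dir a)) →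
      ContinuousAt (R a) w := by
    intro a w hw
    have hwp : w ≠ pt a := by simpa using hw 0 ⟨le_rfl, hr.le⟩
    refine ContinuousAt.comp (g := principalSqrt)
      (continuousAt_principalSqrt (div_mem_slitPlane hr.le hwp hw)) ?_
    exact ContinuousAt.div (by fun_prop) (by fun_prop) (sub_ne_zero.2 hwp)
  have Y_cont : ∀ h w, w ∉ range (mid h) → ContinuousAt (Y h) w := fun h w hw =>
    (hYc h).continuousAt ((isCompact_range (mid h).continuous).isClosed.isOpen_compl.mem_nhds hw)
  have probe_off : ∀ a h, circleMap (pt a) (r / 2) (dir a) ∉ range (mid h) := by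
    rintro a h ⟨x, hx⟩
    have hm : t₀ h + (t₁ h - t₀ h) * x ∈ Icc (t₀ h) (t₁ h) :=
      ⟨by nlinarith [x.2.1, ht h], by nlinarith [x.2.2, ht h]⟩
    change γ h _ = _ at hx
    have hd : dist (γ h (t₀ h + (t₁ h - t₀ h) * x)) (pt a) = r / 2 := by
      rw [hx, dist_circleMap_center _ half_mem.1]
    obtain ⟨i, h1, h2⟩ := mid_near h _ hm a (by rw [hd]; exact half_mem.2)
    rw [h2, ← h1] at hd
    have := tip_dist (h, i)
    simp only at this
    linarith
  have probe_off' : ∀ a b, pt a ≠ pt b → ∀ s ∈ Icc 0 r,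
      circleMap (pt a) (r / 2) (dir a) ≠ circleMap (pt b) s (dir b) := by
    intro a b hne s hs he
    refine hne (spoke_near a (r / 2) (dir a) half_mem b ?_)
    rw [he, dist_circleMap_center _ hs.1]
    exact hs.2
  refine ⟨{ pt := pt, dir := dir, radius := r / 2, curve := curve, core := core
            root := fun h w => (w - pt (h, false)) * R (h, false) w * Y h w / R (h, true) w
            dir_mem := fun a => Complex.arg_mem_Ioc _
            dir_inj := ?_, circle_avoids := ?_, circle_curve := ?_, curve_inter := ?_
            core_isPreconnected := ?_, core_subset := ?_, core_avoids := ?_, probe_mem := ?_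
            root_sq := ?_, continuousAt_root := ?_, root_flip := ?_ }, rfl⟩
  · intro a b h1 h2
    refine end_inj a b h1 ?_
    rw [← tip_eq, ← tip_eq, h1, h2]
  · intro a θ b he
    have h1 := spoke_near a (r / 2) θ half_mem b (by rw [he, dist_self]; exact hr.le)
    have h2 := dist_circleMap_center (pt a) half_mem.1 θ
    rw [he, h1, dist_self] at h2
    linarith
  · intro a θ k hk
    have hd := dist_circleMap_center (pt a) half_mem.1 θ
    rcases hk with ⟨i, s, hs, he⟩ | ⟨t, h1, he⟩
    · have h2 := spoke_near (k, i) s (dir (k, i)) hs a (by rw [← he, hd]; exact half_mem.2)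
      have h3 := dist_circleMap_center (pt (k, i)) hs.1 (dir (k, i))
      rw [← he, h2, hd] at h3
      refine ⟨i, h2, ?_⟩
      rw [← h3, h2] at he
      simp only [circleMap, add_right_inj] at he
      have h4 := mul_left_cancel₀ (by exact_mod_cast (half_pos hr).ne') he
      obtain ⟨n, hn⟩ := Complex.exp_eq_exp_iff_exists_int.1 h4
      refine ⟨n, ?_⟩
      have h5 : (θ : ℂ) * Complex.I = ((dir (k, i) + n * (2 * Real.pi) : ℝ) : ℂ) * Complex.I := by
        rw [hn]
        push_cast
        ring
      exact_mod_cast mul_right_cancel₀ Complex.I_ne_zero h5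
    · obtain ⟨i, h2, h3⟩ := mid_near k t h1 a (by rw [← he, hd]; exact half_mem.2)
      have h4 := tip_dist (k, i)
      simp only at h4
      rw [he, h3, ← h2, h4] at hd
      linarith
  · have hms : ∀ h k w, h ≠ k → (∃ t ∈ Icc (t₀ h) (t₁ h), w = γ h t) →
        (∃ i, ∃ s ∈ Icc 0 r, w = circleMap (pt (k, i)) s (dir (k, i))) → False := by
      rintro h k w hne ⟨t, h1, h2⟩ ⟨i, s, hs, h3⟩
      have h4 := dist_circleMap_center (pt (k, i)) hs.1 (dir (k, i))
      rw [← h3, h2] at h4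
      obtain ⟨j, h5, h6⟩ := mid_near h t h1 (k, i) (by rw [h4]; exact hs.2)
      have h7 := tip_dist (h, j)
      simp only at h7
      rw [h6, ← h5, h7] at h4
      rw [h2, ← h4, tip_eq] at h3
      exact hne (mid_inj _ _ _ _ h1 (time_mem (k, i)) h3)
    rintro h k w hne (⟨i, s, hs, h1⟩ | h1) (⟨j, s', hs', h2⟩ | h2)
    · have h3 := dist_circleMap_center (pt (k, j)) hs'.1 (dir (k, j))
      have h4 := dist_circleMap_center (pt (h, i)) hs.1 (dir (h, i))
      rw [← h1] at h4
      rw [← h2] at h3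
      have h5 := spoke_near (h, i) s (dir (h, i)) hs (k, j) (by rw [← h1, h3]; exact hs'.2)
      rw [h5, h3] at h4
      rcases hs.1.eq_or_lt with h6 | h6
      · refine ⟨(h, i), ?_⟩
        rw [h1, ← h6, circleMap_zero_radius]
        rfl
      · refine absurd (congrArg Prod.fst (end_inj (h, i) (k, j) h5 ?_)) hne
        rw [← tip_eq, ← tip_eq, h5]
        rw [h1, h5, h4] at h2
        simp only [circleMap, add_right_inj] at h2 ⊢
        rw [mul_left_cancel₀ (by exact_mod_cast h6.ne') h2]
    · exact (hms k h w hne.symm h2 ⟨i, s, hs, h1⟩).elim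
    · exact (hms h k w hne h1 ⟨j, s', hs', h2⟩).elim
    · obtain ⟨t, ht1, ht2⟩ := h1
      obtain ⟨t', ht1', ht2'⟩ := h2
      exact absurd (mid_inj h k t t' ht1 ht1' (ht2.symm.trans ht2')) hne
  · intro h
    have h1 : ∀ a, IsPreconnected (spoke a) := fun a =>
      isPreconnected_Icc.image _ (spoke_cont a).continuousOn
    have h2 : IsPreconnected (γ h '' Icc (t₀ h) (t₁ h)) := isPreconnected_Icc.image _ (mid_cont h)
    have h3 : ∀ a, γ a.1 (time a) ∈ spoke a := fun a => ⟨r, ⟨by linarith, le_rfl⟩, tip_eq a⟩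
    have h4 : ∀ i, γ h (time (h, i)) ∈ γ h '' Icc (t₀ h) (t₁ h) := fun i =>
      mem_image_of_mem _ (time_mem (h, i))
    exact ((h1 _).union _ (h3 (h, false)) (h4 false) h2).union _ (Or.inr (h4 true))
      (h3 (h, true)) (h1 _)
  · rintro h w ((⟨s, hs, rfl⟩ | ⟨t, h1, rfl⟩) | ⟨s, hs, rfl⟩)
    · exact Or.inl ⟨false, s, ⟨by linarith [hs.1], hs.2⟩, rfl⟩
    · exact Or.inr ⟨t, h1, rfl⟩
    · exact Or.inl ⟨true, s, ⟨by linarith [hs.1], hs.2⟩, rfl⟩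
  · have key : ∀ a b, pt b ∉ spoke a := by
      rintro a b ⟨s, hs, he⟩
      simp only at he
      have hs' : s ∈ Icc 0 r := ⟨by linarith [hs.1], hs.2⟩
      have h1 := spoke_near a s (dir a) hs' b (by rw [he, dist_self]; exact hr.le)
      have h2 := dist_circleMap_center (pt a) hs'.1 (dir a)
      rw [he, h1, dist_self] at h2
      linarith [hs.1]
    rintro h b ((h1 | ⟨t, h1, h2⟩) | h1)
    · exact key _ _ h1
    · obtain ⟨i, h3, h4⟩ := mid_near h t h1 b (by rw [h2, dist_self]; exact hr.le)
      have h5 := tip_dist (h, i)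
      simp only at h5
      rw [← h4, h2, h3, dist_self] at h5
      exact hr.ne h5
    · exact key _ _ h1
  · have key : ∀ a, circleMap (pt a) (r / 2) (dir a) ∈ spoke a := fun a =>
      ⟨r / 2, ⟨le_rfl, by linarith⟩, rfl⟩
    rintro ⟨h, i⟩
    cases i
    · exact Or.inl (Or.inl (key _))
    · exact Or.inr (key _)
  · intro h w hw
    have hp : ∀ i, w - pt (h, i) ≠ 0 := by
      intro i he
      exact hw (Or.inl ⟨i, 0, ⟨le_rfl, hr.le⟩, by
        rw [circleMap_zero_radius]
        exact sub_eq_zero.1 he⟩)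
    have hq : ∀ i, w - circleMap (pt (h, i)) r (dir (h, i)) ≠ 0 := by
      intro i he
      exact hw (Or.inl ⟨i, r, ⟨hr.le, le_rfl⟩, sub_eq_zero.1 he⟩)
    have hY := hYs h w fun h' => hw (mid_range h h')
    rw [mid_zero, mid_one, ← tip_eq (h, false), ← tip_eq (h, true)] at hY
    have h1 := hp false
    have h2 := hp true
    have h3 := hq false
    have h4 := hq true
    simp only [R]
    rw [div_pow, mul_pow, mul_pow, hY, principalSqrt_sq (div_ne_zero h3 h1),
      principalSqrt_sq (div_ne_zero h4 h2)]
    field_simp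
  · intro h w hw
    refine ContinuousAt.div (ContinuousAt.mul (ContinuousAt.mul (by fun_prop) ?_) ?_) ?_
      (principalSqrt_ne_zero _)
    · exact R_cont _ _ fun s hs he => hw (Or.inl ⟨false, s, hs, he⟩)
    · exact Y_cont h w fun h' => hw (mid_range h h')
    · exact R_cont _ _ fun s hs he => hw (Or.inl ⟨true, s, hs, he⟩)
  · have hcirc : ∀ (f : ℂ → ℂ) (a : H × Bool),
        ContinuousAt f (circleMap (pt a) (r / 2) (dir a)) →
        Tendsto (fun θ => f (circleMap (pt a) (r / 2) θ)) (𝓝 (dir a))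
          (𝓝 (f (circleMap (pt a) (r / 2) (dir a)))) := fun f a hf =>
      ContinuousAt.comp (f := circleMap (pt a) (r / 2)) hf (continuous_circleMap _ _).continuousAt
    rintro ⟨h, i⟩
    obtain ⟨L, hL, h1, h2⟩ := exists_tendsto_sqrt_circleMap (pt (h, i)) hr (dir (h, i))
    have hYt := hcirc (Y h) (h, i) (Y_cont _ _ (probe_off _ _))
    have hpt := hcirc (· - pt (h, false)) (h, i) (by fun_prop)
    cases i
    · have hRt := hcirc (R (h, true)) (h, false) (R_cont _ _ (probe_off' _ _ (hends h)))
      have hA := (((hpt.mono_left (nhdsWithin_le_nhds (s := Ioi _))).mul h1).mul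
        (hYt.mono_left nhdsWithin_le_nhds)).div (hRt.mono_left nhdsWithin_le_nhds)
        (principalSqrt_ne_zero _)
      refine ⟨_, hA, ?_⟩
      have := (((hpt.mono_left (nhdsWithin_le_nhds (s := Iio _))).mul h2).mul
        (hYt.mono_left nhdsWithin_le_nhds)).div (hRt.mono_left nhdsWithin_le_nhds)
        (principalSqrt_ne_zero _)
      rw [mul_neg, neg_mul, neg_div] at this
      exact this
    · have hRt := hcirc (R (h, false)) (h, true) (R_cont _ _ (probe_off' _ _ (hends h).symm))
      have hA := (((hpt.mono_left (nhdsWithin_le_nhds (s := Ioi _))).mul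
        (hRt.mono_left nhdsWithin_le_nhds)).mul (hYt.mono_left nhdsWithin_le_nhds)).div h1 hL
      refine ⟨_, hA, ?_⟩
      have := (((hpt.mono_left (nhdsWithin_le_nhds (s := Iio _))).mul
        (hRt.mono_left nhdsWithin_le_nhds)).mul
        (hYt.mono_left nhdsWithin_le_nhds)).div h2 (neg_ne_zero.2 hL)
      rw [div_neg] at this
      exact this

/-- A rotation system for finitely many arcs with disjoint interiors in the plane: every even set of
arcs is the boundary of a two-colouring of the sectors. -/
theorem exists_planar_rotation {H : Type*} [Fintype H] [DecidableEq H] (γ : H → ℝ → ℂ)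
    (hγ : ∀ h, ContinuousOn (γ h) (Icc 0 1)) (hinj : ∀ h, InjOn (γ h) (Icc 0 1))
    (hdisj : ∀ h k, h ≠ k → ∀ t ∈ Ioo (0 : ℝ) 1, ∀ s ∈ Icc (0 : ℝ) 1, γ h t ≠ γ k s) :
    ∃ (ρ : Equiv.Perm (H × Bool)) (tw : H → ZMod 2),
      (∀ p, ρ.IsCycleOn {a | arcEnd γ a = p}) ∧
      ∀ z : H → ZMod 2, (∀ p, (∑ a, if arcEnd γ a = p then z a.1 else 0) = 0) →
        ∃ g : H × Bool → ZMod 2, (∀ a, g (ρ a) = g a + z (ρ a).1) ∧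
          ∀ h, g (h, true) = g (h, false) + tw h * z h := by
  obtain ⟨B, hB⟩ := exists_branchSystem γ hγ hinj hdisj
  exact hB ▸ B.exists_rotation_twist

/-- The restriction of a permutation to one layer of a product. -/
def Equiv.Perm.layer {α β : Type*} (ρ : Equiv.Perm (α × β)) (h : ∀ a, (ρ a).2 = a.2) (b : β) :
    Equiv.Perm α where
  toFun x := (ρ (x, b)).1
  invFun x := (ρ.symm (x, b)).1
  left_inv x := by
    have h1 : ((ρ (x, b)).1, b) = ρ (x, b) := Prod.ext rfl (h (x, b)).symm
    beta_reduce
    rw [h1, Equiv.symm_apply_apply]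
  right_inv x := by
    have h2 := h (ρ.symm (x, b))
    rw [Equiv.apply_symm_apply] at h2
    have h1 : ((ρ.symm (x, b)).1, b) = ρ.symm (x, b) := Prod.ext rfl h2
    beta_reduce
    rw [h1, Equiv.apply_symm_apply]

theorem Equiv.Perm.layer_mk {α β : Type*} (ρ : Equiv.Perm (α × β)) (h : ∀ a, (ρ a).2 = a.2)
    (b : β) (x : α) : (ρ.layer h b x, b) = ρ (x, b) :=
  Prod.ext rfl (h (x, b)).symm

theorem Equiv.Perm.SameCycle.layer {α β : Type*} [Finite α] [Finite β] {ρ : Equiv.Perm (α × β)}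
    (h : ∀ a, (ρ a).2 = a.2) {b : β} {x y : α} (hxy : ρ.SameCycle (x, b) (y, b)) :
    (ρ.layer h b).SameCycle x y := by
  refine (hxy.of_forall_apply (P := fun a => a.2 = b ∧ (ρ.layer h b).SameCycle x a.1) ?_
    ⟨Eq.refl b, Equiv.Perm.SameCycle.refl _ _⟩).2
  rintro ⟨a, _⟩ ⟨rfl, ha⟩
  exact ⟨h _, Equiv.Perm.sameCycle_apply_right.2 ha⟩

namespace OnePlanarDrawing

variable {V : Type*} {G : SimpleGraph V} (D : OnePlanarDrawing G)

/-- The crossing point of an edge, or an arbitrary interior point if there is none. -/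
theorem exists_crossing (e : G.edgeSet) : ∃ τ ∈ Ioo (0 : ℝ) 1, ∀ f ≠ e, ∀ t ∈ Ioo (0 : ℝ) 1,
    ∀ s ∈ Ioo (0 : ℝ) 1, D.arc e t = D.arc f s → t = τ := by
  by_cases h : ∃ f ≠ e, ∃ t ∈ Ioo (0 : ℝ) 1, ∃ s ∈ Ioo (0 : ℝ) 1, D.arc e t = D.arc f s
  · obtain ⟨f, hf, t, ht, s, hs, hts⟩ := h
    refine ⟨t, ht, fun f' hf' t' ht' s' hs' hts' => ?_⟩
    have hff : f' = f := D.at_most_one_crossing e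
      ⟨hf', D.arc e t', ⟨t', ht', rfl⟩, ⟨s', hs', hts'.symm⟩⟩
      ⟨hf, D.arc e t, ⟨t, ht, rfl⟩, ⟨s, hs, hts.symm⟩⟩
    subst hff
    exact D.arc_inj e (Ioo_subset_Icc_self ht') (Ioo_subset_Icc_self ht)
      (D.crossings_subsingleton e f' hf.symm ⟨⟨t', ht', rfl⟩, ⟨s', hs', hts'.symm⟩⟩
        ⟨⟨t, ht, rfl⟩, ⟨s, hs, hts.symm⟩⟩)
  · push Not at h
    exact ⟨1 / 2, by norm_num, fun f hf t ht s hs hts => absurd hts (h f hf t ht s hs)⟩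

/-- The parameter of the crossing point. -/
noncomputable def crossing (e : G.edgeSet) : ℝ := (D.exists_crossing e).choose

theorem crossing_mem (e : G.edgeSet) : D.crossing e ∈ Ioo (0 : ℝ) 1 :=
  (D.exists_crossing e).choose_spec.1

theorem eq_crossing {e f : G.edgeSet} (h : f ≠ e) {t s : ℝ} (ht : t ∈ Ioo (0 : ℝ) 1)
    (hs : s ∈ Ioo (0 : ℝ) 1) (hts : D.arc e t = D.arc f s) : t = D.crossing e :=
  (D.exists_crossing e).choose_spec.2 f h t ht s hs hts

/-- The edge of a dart. -/
def dartEdge (d : G.Dart) : G.edgeSet := ⟨d.edge, d.edge_mem⟩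

theorem dartEdge_symm (d : G.Dart) : dartEdge d.symm = dartEdge d := Subtype.ext d.edge_symm

theorem exists_start (d : G.Dart) : ∃ x : ℝ, (x = 0 ∨ x = 1) ∧
    D.arc (dartEdge d) x = D.pos d.fst := by
  obtain ⟨u, v, he, h0, h1⟩ := D.arc_ends (dartEdge d)
  have hd : d.edge = s(u, v) := he
  rcases SimpleGraph.dart_edge_eq_mk'_iff'.1 hd with ⟨h, -⟩ | ⟨h, -⟩
  · exact ⟨0, Or.inl rfl, by rw [h0, h]⟩
  · exact ⟨1, Or.inr rfl, by rw [h1, h]⟩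

/-- The parameter at which the arc of a dart leaves its source. -/
noncomputable def start (d : G.Dart) : ℝ := (D.exists_start d).choose

theorem start_eq (d : G.Dart) : D.start d = 0 ∨ D.start d = 1 := (D.exists_start d).choose_spec.1

theorem arc_start (d : G.Dart) : D.arc (dartEdge d) (D.start d) = D.pos d.fst :=
  (D.exists_start d).choose_spec.2

theorem start_symm (d : G.Dart) : D.start d.symm = 1 - D.start d := by
  have hne : D.start d.symm ≠ D.start d := fun h => d.adj.ne' (D.pos_inj (by
    have h1 := D.arc_start d.symm
    rw [dartEdge_symm, h, D.arc_start] at h1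
    exact h1.symm))
  rcases D.start_eq d with h | h <;> rcases D.start_eq d.symm with h' | h'
  · exact absurd (h'.trans h.symm) hne
  · rw [h, h', sub_zero]
  · rw [h, h', sub_self]
  · exact absurd (h'.trans h.symm) hne

/-- The parametrization of the half of an edge from the source to the crossing point. -/
noncomputable def param (d : G.Dart) (t : ℝ) : ℝ :=
  (1 - t) * D.start d + t * D.crossing (dartEdge d)

theorem param_mem_Ioo (d : G.Dart) {t : ℝ} (ht : t ∈ Ioc (0 : ℝ) 1) :
    D.param d t ∈ Ioo (0 : ℝ) 1 := by
  obtain ⟨h1, h2⟩ := D.crossing_mem (dartEdge d)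
  obtain ⟨h3, h4⟩ := ht
  unfold param
  rcases D.start_eq d with h | h <;> rw [h] <;> constructor <;> nlinarith

theorem param_zero (d : G.Dart) : D.param d 0 = D.start d := by
  simp [param]

theorem param_one (d : G.Dart) : D.param d 1 = D.crossing (dartEdge d) := by
  simp [param]

theorem param_mem_Icc (d : G.Dart) {t : ℝ} (ht : t ∈ Icc (0 : ℝ) 1) :
    D.param d t ∈ Icc (0 : ℝ) 1 := by
  rcases ht.1.eq_or_lt with rfl | h
  · rw [param_zero]
    rcases D.start_eq d with h | h <;> simp [h]
  · exact Ioo_subset_Icc_self (D.param_mem_Ioo d ⟨h, ht.2⟩)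

theorem param_injective (d : G.Dart) : Function.Injective (D.param d) := by
  intro t s hts
  obtain ⟨h1, h2⟩ := D.crossing_mem (dartEdge d)
  have h : (t - s) * (D.crossing (dartEdge d) - D.start d) = 0 := by
    unfold param at hts
    linear_combination hts
  refine sub_eq_zero.1 ((mul_eq_zero.1 h).resolve_right fun h' => ?_)
  rcases D.start_eq d with h3 | h3 <;> rw [h3] at h' <;> linarith

/-- The half of an edge from the source of a dart to the crossing point. -/
noncomputable def half (d : G.Dart) (t : ℝ) : ℂ :=
  Complex.equivRealProd.symm (D.arc (dartEdge d) (D.param d t))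

theorem half_eq_half {d k : G.Dart} {t s : ℝ} : D.half d t = D.half k s ↔
    D.arc (dartEdge d) (D.param d t) = D.arc (dartEdge k) (D.param k s) :=
  Complex.equivRealProd.symm.injective.eq_iff

theorem continuousOn_half (d : G.Dart) : ContinuousOn (D.half d) (Icc 0 1) := by
  have h : Continuous (D.param d) := by
    unfold param
    fun_prop
  exact Complex.equivRealProdCLM.symm.continuous.comp_continuousOn
    ((D.arc_cont (dartEdge d)).comp h.continuousOn fun t => D.param_mem_Icc d)

theorem injOn_half (d : G.Dart) : InjOn (D.half d) (Icc 0 1) := fun _ ht _ hs h =>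
  D.param_injective d (D.arc_inj _ (D.param_mem_Icc d ht) (D.param_mem_Icc d hs)
    (D.half_eq_half.1 h))

theorem half_zero (d : G.Dart) : D.half d 0 = Complex.equivRealProd.symm (D.pos d.fst) := by
  rw [half, param_zero, arc_start]

theorem half_one_ne (d : G.Dart) (v : V) : D.half d 1 ≠ Complex.equivRealProd.symm (D.pos v) :=
  fun h => D.arc_avoids (dartEdge d) _ (D.param_mem_Ioo d (right_mem_Ioc.2 one_pos))
    ⟨v, (Complex.equivRealProd.symm.injective h).symm⟩

theorem half_disjoint (d k : G.Dart) (hdk : d ≠ k) (t : ℝ) (ht : t ∈ Ioo (0 : ℝ) 1) (s : ℝ)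
    (hs : s ∈ Icc (0 : ℝ) 1) : D.half d t ≠ D.half k s := by
  intro h
  have hd := D.param_mem_Ioo d (Ioo_subset_Ioc_self ht)
  rcases hs.1.eq_or_lt with rfl | hs0
  · rw [half_zero] at h
    exact D.arc_avoids (dartEdge d) _ hd ⟨_, (Complex.equivRealProd.symm.injective h).symm⟩
  have hk := D.param_mem_Ioo k ⟨hs0, hs.2⟩
  rw [half_eq_half] at h
  by_cases he : dartEdge k = dartEdge d
  · rw [he] at h
    have h1 := D.arc_inj _ (Ioo_subset_Icc_self hd) (Ioo_subset_Icc_self hk) h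
    have h2 : d = k ∨ d = k.symm :=
      (SimpleGraph.dart_edge_eq_iff d k).1 (congrArg Subtype.val he.symm)
    obtain rfl := h2.resolve_left hdk
    obtain ⟨h3, h4⟩ := D.crossing_mem (dartEdge k)
    obtain ⟨h5, h6⟩ := ht
    obtain ⟨h7, h8⟩ := hs
    rw [param, param, start_symm, dartEdge_symm] at h1
    rcases D.start_eq k with h9 | h9 <;> rw [h9] at h1 <;> nlinarith
  · have h1 := D.eq_crossing he hd hk h
    rw [← param_one] at h1
    exact ht.2.ne (D.param_injective d h1)

theorem half_one_eq {d k : G.Dart} (h : D.half k 1 = D.half d 1) (hne : k.edge ≠ d.edge) :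
    dartEdge k ∈ {f : G.edgeSet | f ≠ dartEdge d ∧
      (D.arc (dartEdge d) '' Ioo 0 1 ∩ D.arc f '' Ioo 0 1).Nonempty} := by
  have hm := fun d : G.Dart => D.param_mem_Ioo d (right_mem_Ioc.2 one_pos)
  exact ⟨fun h' => hne (congrArg Subtype.val h'), _, ⟨_, hm d, rfl⟩,
    ⟨_, hm k, D.half_eq_half.1 h⟩⟩

theorem nonempty_linkSystem {V : Type*} {G : SimpleGraph V} [Fintype V] [DecidableEq V]
    [DecidableRel G.Adj] (D : OnePlanarDrawing G) (hmin : ∀ v, 2 ≤ G.degree v) :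
    Nonempty (LinkSystem G) := by
  classical
  obtain ⟨ρ, tw, hρ, hcol⟩ := exists_planar_rotation D.half D.continuousOn_half D.injOn_half
    D.half_disjoint
  set c : V → ℂ := fun v => Complex.equivRealProd.symm (D.pos v) with hc
  have hcinj : Function.Injective c := Complex.equivRealProd.symm.injective.comp D.pos_inj
  have e0 : ∀ d, arcEnd D.half (d, false) = c d.fst := fun d => D.half_zero d
  have e1 : ∀ d, arcEnd D.half (d, true) = D.half d 1 := fun d => rfl
  have hend : ∀ a, arcEnd D.half (ρ a) = arcEnd D.half a := fun a => (hρ _).1.mapsTo rfl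
  have hlayer : ∀ a, (ρ a).2 = a.2 := by
    rintro ⟨d, b⟩
    have h := hend (d, b)
    rcases hb : ρ (d, b) with ⟨k, b'⟩
    rw [hb] at h
    cases b <;> cases b'
    · rfl
    · rw [e0, e1] at h
      exact absurd h (D.half_one_ne _ _)
    · rw [e0, e1] at h
      exact absurd h.symm (D.half_one_ne _ _)
    · rfl
  have hfst : ∀ d, (ρ.layer hlayer false d).fst = d.fst := fun d => hcinj (by
    rw [← e0, Equiv.Perm.layer_mk, hend, e0])
  have hnode : ∀ d, D.half (ρ.layer hlayer true d) 1 = D.half d 1 := fun d => by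
    rw [← e1, Equiv.Perm.layer_mk, hend, e1]
  let N : NodeRotation G ℂ :=
    { node := fun d => D.half d 1
      turn := ρ.layer hlayer true
      node_symm := fun d => by rw [half_eq_half, param_one, param_one, dartEdge_symm]
      node_three := fun d k l hk hl => by
        by_contra! h
        exact h.2.2 (congrArg Subtype.val (D.at_most_one_crossing _ (D.half_one_eq hk h.1)
          (D.half_one_eq hl h.2.1)))
      node_turn := hnode
      sameCycle := fun d k h => ((hρ (D.half d 1)).2 (e1 d) h).layer hlayer }
  refine ⟨N.linkSystem (ρ.layer hlayer false) tw hfst (fun d h => ?_) fun z hv hn => ?_⟩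
  · have h1 : 1 < (Finset.univ.filter fun k : G.Dart => k.fst = d.fst).card := by
      rw [LinkSystem.card_dart_fiber]
      exact hmin _
    obtain ⟨k, hk, hkd⟩ := Finset.exists_mem_ne h1 d
    have hk' : arcEnd D.half (k, false) = c d.fst := by
      rw [e0, (Finset.mem_filter.1 hk).2]
    exact hkd ((((hρ (c d.fst)).2 (e0 d) hk').layer hlayer).of_forall_apply (P := fun k => k = d)
      (fun _ ha => ha.symm ▸ h) rfl)
  · obtain ⟨g, hg, hg'⟩ := hcol z fun p => by
      have s0 : (∑ d, if arcEnd D.half (d, false) = p then z d else 0) = 0 := by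
        by_cases hp : ∃ v, c v = p
        · obtain ⟨v, rfl⟩ := hp
          simpa only [e0, hcinj.eq_iff] using hv v
        · exact Finset.sum_eq_zero fun d _ => if_neg fun h => hp ⟨_, (e0 d).symm.trans h⟩
      have s1 : (∑ d, if arcEnd D.half (d, true) = p then z d else 0) = 0 := by
        by_cases hp : ∃ d, D.half d 1 = p
        · obtain ⟨d, rfl⟩ := hp
          exact hn d
        · exact Finset.sum_eq_zero fun d _ => if_neg fun h => hp ⟨d, h⟩
      rw [Fintype.sum_prod_type_right, Fintype.sum_bool, s0, s1, add_zero]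
    refine ⟨fun d => g (d, false), fun d => g (d, true), fun d => ?_, fun d => ?_, hg'⟩
    · change g (ρ.layer hlayer false d, false) = _
      rw [Equiv.Perm.layer_mk, hg]
      rfl
    · change g (ρ.layer hlayer true d, true) = _
      rw [Equiv.Perm.layer_mk, hg]
      rfl

end OnePlanarDrawing

end

/-- Every 1-planar graph with minimum degree 7 contains a 7-vertex w₀ with a
7-neighbor w₁ lying on a common triangle, such that all neighbors of w₀ have
degree at most 23. -/
theorem one_planar_7vertex_structure {V : Type*} [Fintype V] [Nonempty V]
    (G : SimpleGraph V) [DecidableRel G.Adj] (h1p : G.IsOnePlanar)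
    (hmin : ∀ v : V, 7 ≤ G.degree v) :
    ∃ w₀ w₁ : V, G.Adj w₀ w₁ ∧ G.degree w₀ = 7 ∧ G.degree w₁ = 7 ∧
      (∃ w₂ : V, G.Adj w₀ w₂ ∧ G.Adj w₁ w₂) ∧
      (∀ u : V, G.Adj w₀ u → G.degree u ≤ 23) := by
  classical
  obtain ⟨D⟩ := h1p
  obtain ⟨S⟩ := D.nonempty_linkSystem fun v => le_trans (by norm_num) (hmin v)
  obtain ⟨u, v, w, huv, huw, hvw, hu, hv, hx⟩ := S.exists_light_triangle hmin
  exact ⟨u, v, huv, hu, hv, ⟨w, huw, hvw⟩, hx⟩
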